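/- Weil-type bound for Kloosterman sums over ℚ: for integers a₁, a₂ and c ≥ 1, the Kloosterman sum S(a₁, a₂; c) = Σ_{x mod c, gcd(x,c)=1} e((a₁ x + a₂ x̄)/c), where x x̄ ≡ 1 (mod c), satisfies |S(a₁,a₂;c)| ≤ d(c) · gcd(a₁,a₂,c)^{1/2} · c^{1/2}, where d(c) is the number of divisors of c. -/

import Mathlib

open Polynomial in
/-- A squarefree nonconstant polynomial is not a constant times a square of a rational function. -/
theorem klo_sqfree {K : Type*} [Field K] (h : K[X]) (hs : Squarefree h) (hd : 0 < h.natDegree)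
    (c : K) (hc : c ≠ 0) : ∀ (n : ℕ) (A B : K[X]), A.natDegree ≤ n → h * A ^ 2 = C c * B ^ 2 → A = 0 := by
  have hrad : IsRadical h := hs.isRadical
  have hunit : IsUnit (C c) := by simpa using hc
  intro n
  induction n using Nat.strong_induction_on with
  | _ n ih =>
  intro A B hA hAB
  by_contra hA0
  have h0 : h ≠ 0 := by rintro rfl; simp at hd
  have h1 : h ∣ B := by
    apply hrad 2
    have : h ∣ C c * B ^ 2 := ⟨_, hAB.symm⟩
    exact (IsUnit.dvd_mul_left hunit).1 this
  obtain ⟨B', rfl⟩ := h1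
  have h2 : A ^ 2 = h * (C c * B' ^ 2) := by
    apply mul_left_cancel₀ h0
    rw [hAB]; ring
  have h3 : h ∣ A := hrad 2 _ ⟨_, h2⟩
  obtain ⟨A', rfl⟩ := h3
  have h4 : h * A' ^ 2 = C c * B' ^ 2 := by
    apply mul_left_cancel₀ h0
    rw [← h2]; ring
  have hA'0 : A' ≠ 0 := by rintro rfl; simp at hA0
  rw [natDegree_mul h0 hA'0] at hA
  exact hA'0 (ih (A'.natDegree) (by omega) A' B' le_rfl h4)

open Polynomial in
theorem klo_indep {K : Type*} [Field K] (p : ℕ) [Fact p.Prime] [CharP K p] (m e A : ℕ)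
    (he : 2 * e + 1 = p ^ m)
    (h : K[X]) (hs : Squarefree h) (hd : 0 < h.natDegree) (h0 : h.eval 0 ≠ 0)
    (hA : h.natDegree + 2 * A < p ^ m) :
    ∀ (B : ℕ) (a b : ℕ → K[X]), (∀ i, (a i).natDegree ≤ A) → (∀ i, (b i).natDegree ≤ A) →
      ∑ i ∈ Finset.range B, (a i + b i * h ^ e) * X ^ (i * p ^ m) = 0 →
      ∀ i < B, a i = 0 ∧ b i = 0 := by
  intro B
  induction B with
  | zero => intro a b _ _ _ i hi; omega
  | succ B ih =>
  intro a b ha hb hsum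
  rw [Finset.sum_range_succ'] at hsum
  set R := ∑ i ∈ Finset.range B, (a (i+1) + b (i+1) * h ^ e) * X ^ (i * p ^ m) with hR
  have e1 : ∑ i ∈ Finset.range B, (a (i+1) + b (i+1) * h ^ e) * X ^ ((i+1) * p ^ m)
      = X ^ (p ^ m) * R := by
    rw [hR, Finset.mul_sum]
    apply Finset.sum_congr rfl
    intro i _
    rw [add_mul i 1, one_mul, pow_add]; ring
  rw [e1] at hsum
  simp only [zero_mul, pow_zero, mul_one] at hsum
  set c : K := h.eval 0 with hc
  have hX : (X : K[X]) ^ (p ^ m) ∣ h ^ (p ^ m) - C (c ^ (p ^ m)) := by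
    rw [C_pow]
    have : CharP K[X] p := inferInstance
    rw [← sub_pow_char_pow]
    apply pow_dvd_pow_of_dvd
    rw [X_dvd_iff]
    simp [hc, coeff_zero_eq_eval_zero]
  have hX2 : (X : K[X]) ^ (p ^ m) ∣ h * (a 0) ^ 2 - C (c ^ (p ^ m)) * (b 0) ^ 2 := by
    have : h * (a 0) ^ 2 - C (c ^ (p ^ m)) * (b 0) ^ 2 =
        (h ^ (p ^ m) - C (c ^ (p ^ m))) * (b 0) ^ 2
         + X ^ (p ^ m) * ((- R) * h * (a 0 - b 0 * h ^ e)) := by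
      have hh : h ^ (p ^ m) = h * (h ^ e) ^ 2 := by rw [← he]; ring
      rw [hh]
      have h5 : X ^ (p ^ m) * R = -(a 0 + b 0 * h ^ e) := by linear_combination hsum
      have h6 : X ^ (p ^ m) * ((- R) * h * (a 0 - b 0 * h ^ e)) =
        - (X ^ (p ^ m) * R) * h * (a 0 - b 0 * h ^ e) := by ring
      rw [h6, h5]; ring
    rw [this]
    exact dvd_add (Dvd.dvd.mul_right hX _) (dvd_mul_right _ _)
  have hdeg : (h * (a 0) ^ 2 - C (c ^ (p ^ m)) * (b 0) ^ 2).natDegree < p ^ m := by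
    refine lt_of_le_of_lt (natDegree_sub_le _ _) (max_lt ?_ ?_)
    · refine lt_of_le_of_lt natDegree_mul_le ?_
      have := natDegree_pow_le (p := a 0) (n := 2)
      have := ha 0
      omega
    · refine lt_of_le_of_lt natDegree_mul_le ?_
      have := natDegree_pow_le (p := b 0) (n := 2)
      have := hb 0
      rw [natDegree_C]
      omega
  have hz : h * (a 0) ^ 2 - C (c ^ (p ^ m)) * (b 0) ^ 2 = 0 := by
    by_contra hne
    have := natDegree_le_of_dvd hX2 hne
    rw [natDegree_X_pow] at this
    omega
  have hcp : c ^ (p ^ m) ≠ 0 := pow_ne_zero _ h0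
  have ha0 : a 0 = 0 :=
    klo_sqfree h hs hd _ hcp _ (a 0) (b 0) le_rfl (sub_eq_zero.1 hz)
  have hb0 : b 0 = 0 := by
    rw [ha0] at hz
    have : C (c ^ (p ^ m)) * (b 0) ^ 2 = 0 := by simpa using hz
    rcases mul_eq_zero.1 this with h7 | h7
    · exact absurd (C_eq_zero.1 h7) hcp
    · exact pow_eq_zero_iff (two_ne_zero) |>.1 h7
  have hRz : R = 0 := by
    rw [ha0, hb0] at hsum
    have : (X : K[X]) ^ (p ^ m) * R = 0 := by simpa using hsum
    exact (mul_eq_zero.1 this).resolve_left (pow_ne_zero _ X_ne_zero)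
  have := ih (fun i => a (i+1)) (fun i => b (i+1)) (fun i => ha _) (fun i => hb _) hRz
  intro i hi
  cases i with
  | zero => exact ⟨ha0, hb0⟩
  | succ i => exact this i (by omega)

open Polynomial in
theorem klo_natDegree_le {K : Type*} [Field K] {A : ℕ} (f : K[X]) (h : f.degree < ((A + 1 : ℕ) : WithBot ℕ)) :
    f.natDegree ≤ A := by
  rw [natDegree_le_iff_coeff_eq_zero]
  intro n hn
  exact coeff_eq_zero_of_degree_lt (h.trans_le (by exact_mod_cast hn))

open Polynomial in
/-- The auxiliary linear map of the Stepanov method. -/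
noncomputable def kloMap {K : Type*} [Field K] (Q e : ℕ) (ε : K) (h : K[X]) (A B : ℕ) :
    ((Fin B → degreeLT K A) × (Fin B → degreeLT K A)) →ₗ[K] K[X] where
  toFun v := ∑ i : Fin B, X ^ (i : ℕ) * (h ^ e * expand K Q (v.1 i) + C ε * expand K Q (v.2 i))
  map_add' v w := by
    rw [← Finset.sum_add_distrib]
    apply Finset.sum_congr rfl
    intro i _
    simp only [Prod.fst_add, Prod.snd_add, Pi.add_apply, Submodule.coe_add, map_add]
    ring
  map_smul' r v := by
    simp only [RingHom.id_apply]
    rw [Finset.smul_sum]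
    apply Finset.sum_congr rfl
    intro i _
    simp only [Prod.smul_fst, Prod.smul_snd, Pi.smul_apply, Submodule.coe_smul, map_smul,
      mul_smul_comm]
    rw [← smul_add, mul_smul_comm]

open Polynomial in
theorem kloMap_mem {K : Type*} [Field K] (Q e : ℕ) (ε : K) (h : K[X]) (A B : ℕ)
    (v : (Fin B → degreeLT K (A+1)) × (Fin B → degreeLT K (A+1))) (hB : 0 < B) :
    kloMap Q e ε h (A+1) B v ∈ degreeLT K (B + h.natDegree * e + A * Q) := by
  have key : ∀ w : degreeLT K (A+1), (w : K[X]).natDegree ≤ A := by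
    intro w
    have := mem_degreeLT.1 w.2
    exact klo_natDegree_le _ this
  have : (kloMap Q e ε h (A+1) B v).natDegree < B + h.natDegree * e + A * Q := by
    unfold kloMap
    simp only [LinearMap.coe_mk, AddHom.coe_mk]
    refine lt_of_le_of_lt (natDegree_sum_le_of_forall_le (n := (B - 1) + h.natDegree * e + A * Q) _ _ ?_) (by omega)
    intro i _
    refine natDegree_mul_le.trans ?_
    rw [natDegree_X_pow, add_assoc]
    refine add_le_add (by omega) ?_
    refine (natDegree_add_le _ _).trans (max_le ?_ ?_)
    · refine natDegree_mul_le.trans (add_le_add ?_ ?_)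
      · refine natDegree_pow_le.trans (by rw [mul_comm])
      · rw [natDegree_expand]
        exact Nat.mul_le_mul_right _ (key _)
    · refine natDegree_mul_le.trans ?_
      rw [natDegree_C, natDegree_expand]
      have := Nat.mul_le_mul_right Q (key (v.2 i))
      omega
  rw [mem_degreeLT]
  exact lt_of_le_of_lt degree_le_natDegree (by exact_mod_cast this)

open Polynomial in
theorem klo_stepanov {K : Type*} [Field K] [Fintype K] [DecidableEq K] (p : ℕ) [Fact p.Prime] [CharP K p] (m e A B : ℕ)
    (he : 2 * e + 1 = p ^ m) (hcard : Fintype.card K = (p ^ m) ^ 2)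
    (h : K[X]) (hs : Squarefree h) (hd : 0 < h.natDegree) (h0 : h.eval 0 ≠ 0)
    (hA : h.natDegree + 2 * A < p ^ m) (hB : 0 < B)
    (hdim : B + h.natDegree * e + A * p ^ m < 2 * (A + 1) * B) (ε : K) :
    (Finset.univ.filter (fun w : K => h.eval w ≠ 0 ∧ (h.eval w) ^ (e + e * p ^ m) = ε)).card ≤
      A + h.natDegree * e + (B - 1) * p ^ m := by
  set Q := p ^ m with hQ
  have hQ0 : 0 < Q := by omega
  let L := (kloMap Q e ε h (A+1) B).codRestrict (degreeLT K (B + h.natDegree * e + A * Q))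
    (fun v => kloMap_mem Q e ε h A B v hB)
  have hfin : ∀ n, Module.finrank K (degreeLT K n) = n := fun n => by
    rw [LinearEquiv.finrank_eq (degreeLTEquiv K n)]; simp
  have : ∀ n, FiniteDimensional K (degreeLT K n) := fun n =>
    (degreeLTEquiv K n).symm.finiteDimensional
  have hker : LinearMap.ker L ≠ ⊥ := by
    apply LinearMap.ker_ne_bot_of_finrank_lt
    rw [Module.finrank_prod, Module.finrank_pi_fintype]
    simp only [hfin, Finset.sum_const, Finset.card_univ, Fintype.card_fin, smul_eq_mul]
    calc _ < _ := hdim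
      _ = _ := by ring
  obtain ⟨v, hv, hv0⟩ := (Submodule.ne_bot_iff _).1 hker
  have hLv : kloMap Q e ε h (A+1) B v = 0 := by
    have := congrArg Subtype.val (LinearMap.mem_ker.1 hv)
    simpa [L] using this
  -- the polynomials
  let φ := iterateFrobenius K p m
  have hφφ : ∀ x : K, φ (φ x) = x := by
    intro x
    simp only [φ, iterateFrobenius_def]
    rw [← pow_mul, ← sq, ← hcard, FiniteField.pow_card]
  let a : ℕ → K[X] := fun i => if hi : i < B then (v.1 ⟨i, hi⟩ : K[X]).map φ else 0
  let b : ℕ → K[X] := fun i => if hi : i < B then (v.2 ⟨i, hi⟩ : K[X]).map φ else 0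
  have key : ∀ w : degreeLT K (A+1), ((w : K[X]).map φ).natDegree ≤ A := by
    intro w
    have := mem_degreeLT.1 w.2
    exact natDegree_map_le.trans (klo_natDegree_le _ this)
  have ha : ∀ i, (a i).natDegree ≤ A := by
    intro i
    by_cases hi : i < B
    · simp only [a, hi, dite_true]; exact key _
    · simp [a, hi]
  have hb : ∀ i, (b i).natDegree ≤ A := by
    intro i
    by_cases hi : i < B
    · simp only [b, hi, dite_true]; exact key _
    · simp [b, hi]
  have hpow : ∀ f : K[X], (f.map φ) ^ Q = expand K Q f := by
    intro f
    rw [hQ, ← map_iterateFrobenius_expand (p := p), ← map_expand, map_map]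
    have : (iterateFrobenius K p m).comp φ = RingHom.id K := RingHom.ext hφφ
    rw [this, Polynomial.map_id]
  set G : K[X] := ∑ i ∈ Finset.range B, (a i + b i * h ^ e) * X ^ (i * Q) with hG
  have hG0 : G ≠ 0 := by
    intro hG0
    have hz := klo_indep p m e A he h hs hd h0 hA B a b ha hb hG0
    apply hv0
    have inj : ∀ f : K[X], f.map φ = 0 → f = 0 := fun f hf =>
      (Polynomial.map_eq_zero_iff φ.injective).1 hf
    refine Prod.ext (funext fun i => Subtype.ext ?_) (funext fun i => Subtype.ext ?_)
    · have := (hz i i.2).1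
      simp only [a, i.2, dite_true] at this
      simpa using inj _ this
    · have := (hz i i.2).2
      simp only [b, i.2, dite_true] at this
      simpa using inj _ this
  have hGdeg : G.natDegree ≤ A + h.natDegree * e + (B - 1) * Q := by
    refine natDegree_sum_le_of_forall_le _ _ ?_
    intro i hi
    have hi' := Finset.mem_range.1 hi
    refine natDegree_mul_le.trans ?_
    rw [natDegree_X_pow]
    refine add_le_add ?_ (Nat.mul_le_mul_right _ (by omega))
    refine (natDegree_add_le _ _).trans (max_le ((ha i).trans (by omega)) ?_)
    refine natDegree_mul_le.trans (add_le_add (hb i) ?_)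
    exact natDegree_pow_le.trans (by rw [mul_comm])
  have hroot : ∀ w : K, h.eval w ≠ 0 → (h.eval w) ^ (e + e * Q) = ε → G.eval w = 0 := by
    intro w hw hw2
    have hwq : w ^ (Q * Q) = w := by rw [← sq, ← hcard, FiniteField.pow_card]
    have h1 : (h.eval w) ^ e * (G.eval w) ^ Q = 0 := by
      have h2 : (kloMap Q e ε h (A+1) B v).eval w = 0 := by rw [hLv]; simp
      rw [← h2, show (G.eval w) ^ Q = (G ^ Q).eval w from (eval_pow _).symm]
      have : G ^ Q = ∑ i ∈ Finset.range B, ((a i)^Q + (b i)^Q * h ^ (e * Q)) * X ^ (i * (Q * Q)) := by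
        rw [hG, hQ, sum_pow_char_pow]
        apply Finset.sum_congr rfl
        intro i _
        rw [mul_pow, add_pow_char_pow, mul_pow, ← pow_mul, ← pow_mul, mul_assoc]
      rw [this, Finset.sum_range]
      unfold kloMap
      simp only [LinearMap.coe_mk, AddHom.coe_mk, eval_finsetSum, Finset.mul_sum]
      apply Finset.sum_congr rfl
      intro i _
      simp only [a, b, i.2, dite_true, hpow, eval_mul, eval_add, eval_pow, eval_X, eval_C, Fin.eta]
      rw [mul_comm (i : ℕ) (Q * Q), pow_mul w, hwq, ← hw2, pow_add]
      ring
    have h3 := (mul_eq_zero.1 h1).resolve_left (pow_ne_zero _ hw)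
    exact (pow_eq_zero_iff hQ0.ne').1 h3
  refine le_trans ?_ hGdeg
  refine le_trans (Finset.card_le_card (t := G.roots.toFinset) ?_) ?_
  · intro w hw
    rw [Finset.mem_filter] at hw
    rw [Multiset.mem_toFinset, mem_roots hG0]
    exact hroot w hw.2.1 hw.2.2
  · exact (Multiset.toFinset_card_le _).trans (card_roots' G)

open Polynomial in
theorem klo_stepanov' {K : Type*} [Field K] [Fintype K] [DecidableEq K] (p : ℕ) [Fact p.Prime] [CharP K p] (m D : ℕ)
    (hp : p ≠ 2) (hcard : Fintype.card K = (p ^ m) ^ 2)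
    (h : K[X]) (hs : Squarefree h) (hd : 0 < D) (h0 : h.eval 0 ≠ 0)
    (hD : h.natDegree = 2 * D) (hDQ : 4 * D < p ^ m) (ε : K) :
    2 * (Finset.univ.filter (fun w : K => h.eval w ≠ 0 ∧ (h.eval w) ^ ((Fintype.card K - 1) / 2) = ε)).card ≤
      Fintype.card K + (6 * D + 1) * p ^ m := by
  have hodd : Odd (p ^ m) := ((Fact.out : p.Prime).odd_of_ne_two hp).pow
  obtain ⟨e, he⟩ := hodd
  have hexp : (Fintype.card K - 1) / 2 = e + e * p ^ m := by
    rw [hcard, he]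
    have : (2 * e + 1) ^ 2 = 2 * (e + e * (2 * e + 1)) + 1 := by ring
    rw [this]; omega
  rw [hexp]
  have := klo_stepanov p m e (e - D) (e + 2 * D) he.symm hcard h hs (by omega) h0 (by omega) (by omega)
    (by
      rw [hD, he]
      obtain ⟨f, rfl⟩ : ∃ f, e = D + f := ⟨e - D, by omega⟩
      have : D + f - D = f := by omega
      rw [this]
      nlinarith) ε
  refine (Nat.mul_le_mul_left 2 this).trans ?_
  rw [hcard, hD, he]
  obtain ⟨f, rfl⟩ : ∃ f, e = D + f := ⟨e - D, by omega⟩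
  obtain ⟨g, rfl⟩ : ∃ g, D = g + 1 := ⟨D - 1, by omega⟩
  have h1 : g + 1 + f - (g + 1) = f := by omega
  have h2 : g + 1 + f + 2 * (g + 1) - 1 = 3 * g + f + 2 := by omega
  rw [h1, h2]
  nlinarith


open Polynomial in
theorem klo_hpoly {K : Type*} [Field K] (p : ℕ) [Fact p.Prime] [CharP K p] (hp : p ≠ 2) (c : K) (hc : c ≠ 0) :
    Squarefree (((X : K[X]) ^ p - X) ^ 2 - C (4 * c)) ∧
    (((X : K[X]) ^ p - X) ^ 2 - C (4 * c)).natDegree = 2 * p ∧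
    (((X : K[X]) ^ p - X) ^ 2 - C (4 * c)).eval 0 ≠ 0 := by
  have hp1 : 1 < p := (Fact.out : p.Prime).one_lt
  have h2 : (2 : K) ≠ 0 := by
    have : ((2 : ℕ) : K) ≠ 0 := by
      rw [Ne, CharP.cast_eq_zero_iff K p]
      intro h
      exact hp ((Nat.prime_dvd_prime_iff_eq Fact.out Nat.prime_two).1 h)
    exact_mod_cast this
  have h4 : (4 * c : K) ≠ 0 := by
    have : (4 : K) = 2 * 2 := by norm_num
    rw [this]; positivity
  refine ⟨?_, ?_, ?_⟩
  · apply Separable.squarefree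
    have hder : derivative (((X : K[X]) ^ p - X) ^ 2 - C (4 * c)) = - (C 2 * (X ^ p - X)) := by
      simp only [derivative_sub, derivative_pow, derivative_X, derivative_C, CharP.cast_eq_zero, C_0]
      simp
    unfold Separable
    rw [hder]
    refine ⟨C (-(4 * c)⁻¹), C (-(4 * c)⁻¹ * 2⁻¹) * (X ^ p - X), ?_⟩
    have e1 : (C (-(4 * c)⁻¹) : K[X]) * C (4 * c) = -1 := by
      rw [← C_mul]; rw [neg_mul, inv_mul_cancel₀ h4]; simp
    have e2 : (C (-(4 * c)⁻¹ * 2⁻¹) : K[X]) * C 2 = C (-(4 * c)⁻¹) := by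
      rw [← C_mul, mul_assoc, inv_mul_cancel₀ h2, mul_one]
    linear_combination -e1 - (X ^ p - X) ^ 2 * e2
  · have e1 : ((X : K[X]) ^ p - X).natDegree = p := by
      rw [natDegree_sub_eq_left_of_natDegree_lt] <;> simp [hp1]
    rw [natDegree_sub_C, natDegree_pow, e1]
  · simp [(Fact.out : p.Prime).ne_zero]
    exact ⟨fun h => h4 (by rw [h]; ring), hc⟩

open Polynomial in
theorem klo_count {K : Type*} [Field K] [Fintype K] [DecidableEq K] (p : ℕ) [Fact p.Prime] [Algebra (ZMod p) K] (m : ℕ)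
    (hp : p ≠ 2) (hcard : Fintype.card K = (p ^ m) ^ 2) (hm : 4 * p < p ^ m) (a b : ZMod p) (ha : a ≠ 0) (hb : b ≠ 0) :
    Fintype.card K ≤ p * (Finset.univ.filter (fun x : K => x ≠ 0 ∧
      Algebra.trace (ZMod p) K (a • x + b • x⁻¹) = 0)).card + (6 * p + 2) * p ^ m := by
  have : CharP K p := charP_of_injective_algebraMap (algebraMap (ZMod p) K).injective p
  have hp1 : 1 < p := (Fact.out : p.Prime).one_lt
  set α : K := algebraMap (ZMod p) K a with hα
  set β : K := algebraMap (ZMod p) K b with hβ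
  have hα0 : α ≠ 0 := by simpa [hα] using ha
  have hβ0 : β ≠ 0 := by simpa [hβ] using hb
  have h2 : (2 : K) ≠ 0 := by
    have : ((2 : ℕ) : K) ≠ 0 := by
      rw [Ne, CharP.cast_eq_zero_iff K p]
      intro h
      exact hp ((Nat.prime_dvd_prime_iff_eq Fact.out Nat.prime_two).1 h)
    exact_mod_cast this
  have hchar : ringChar K ≠ 2 := by have := ringChar.eq K p; omega
  obtain ⟨hsq, hdeg, hev⟩ := klo_hpoly p hp (α * β) (mul_ne_zero hα0 hβ0)
  set h : K[X] := ((X : K[X]) ^ p - X) ^ 2 - C (4 * (α * β)) with hh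
  have hst := klo_stepanov' p m p hp hcard h hsq (by omega) hev hdeg hm (-1)
  set Nm := Finset.univ.filter (fun w : K => h.eval w ≠ 0 ∧ (h.eval w) ^ ((Fintype.card K - 1) / 2) = -1) with hNm
  set Np := Finset.univ.filter (fun w : K => h.eval w ≠ 0 ∧ IsSquare (h.eval w)) with hNp
  set N0 := Finset.univ.filter (fun x : K => x ≠ 0 ∧
      Algebra.trace (ZMod p) K (a • x + b • x⁻¹) = 0) with hN0
  have h0 : h ≠ 0 := hsq.ne_zero
  have hcover : (Finset.univ : Finset K) ⊆ Nm ∪ Np ∪ h.roots.toFinset := by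
    intro w _
    by_cases hw : h.eval w = 0
    · apply Finset.mem_union_right
      rw [Multiset.mem_toFinset, mem_roots h0]; exact hw
    · apply Finset.mem_union_left
      rw [Finset.mem_union, Finset.mem_filter, Finset.mem_filter]
      rcases FiniteField.pow_dichotomy hchar hw with h1 | h1
      · right
        refine ⟨Finset.mem_univ _, hw, (FiniteField.isSquare_iff hchar hw).2 h1⟩
      · left
        refine ⟨Finset.mem_univ _, hw, ?_⟩
        convert h1 using 2
        have : Fintype.card K % 2 = 1 := FiniteField.odd_card_of_char_ne_two hchar
        omega
  have hc1 : Fintype.card K ≤ Nm.card + Np.card + 2 * p := by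
    have h1 := Finset.card_le_card hcover
    have h2 := Finset.card_union_le (Nm ∪ Np) h.roots.toFinset
    have h3 := Finset.card_union_le Nm Np
    have h4 := (Multiset.toFinset_card_le h.roots).trans (card_roots' h)
    rw [Finset.card_univ] at h1
    omega
  -- the set of pairs
  set P := (Finset.univ : Finset (K × K)).filter (fun z => z.2 ∈ Np ∧ α * z.1 ^ 2 - (z.2 ^ p - z.2) * z.1 + β = 0) with hP
  have hlow : 2 * Np.card ≤ P.card := by
    apply Finset.mul_card_image_le_card_of_maps_to (f := Prod.snd)
    · intro z hz
      exact (Finset.mem_filter.1 hz).2.1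
    · intro w hw
      have hw' := hw
      rw [hNp, Finset.mem_filter] at hw
      obtain ⟨-, hw0, s, hs⟩ := hw
      have hs0 : s ≠ 0 := by rintro rfl; apply hw0; rw [hs]; simp
      have hs' : (w ^ p - w) ^ 2 - 4 * (α * β) = s * s := by
        rw [← hs, hh]; simp
      have hne : (((w ^ p - w) + s) / (2 * α), w) ≠ (((w ^ p - w) - s) / (2 * α), w) := by
        intro he
        have := (Prod.ext_iff.1 he).1
        simp only at this
        field_simp at this
        have h5 : 2 * s = 0 := by linear_combination this
        exact (mul_ne_zero h2 hs0) h5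
      rw [← Finset.card_pair hne]
      apply Finset.card_le_card
      intro z hz
      rw [Finset.mem_insert, Finset.mem_singleton] at hz
      rw [Finset.mem_filter, hP, Finset.mem_filter]
      rcases hz with rfl | rfl
      · refine ⟨⟨Finset.mem_univ _, hw', ?_⟩, rfl⟩
        simp only
        field_simp
        linear_combination -hs'
      · refine ⟨⟨Finset.mem_univ _, hw', ?_⟩, rfl⟩
        simp only
        field_simp
        linear_combination -hs'
  have hup : P.card ≤ p * N0.card := by
    have aux : ∀ z ∈ P, z.1 ≠ 0 ∧ z.2 ^ p - z.2 = a • z.1 + b • z.1⁻¹ := by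
      intro z hz
      have h1 := (Finset.mem_filter.1 hz).2.2
      have hz0 : z.1 ≠ 0 := by
        intro h0
        rw [h0] at h1
        apply hβ0; linear_combination h1
      refine ⟨hz0, ?_⟩
      rw [Algebra.smul_def, Algebra.smul_def, ← hα, ← hβ]
      field_simp
      linear_combination -h1
    apply Finset.card_le_mul_card_image_of_maps_to (f := Prod.fst)
    · intro z hz
      obtain ⟨h1, h2⟩ := aux z hz
      rw [hN0, Finset.mem_filter]
      refine ⟨Finset.mem_univ _, h1, ?_⟩
      rw [← h2, map_sub, sub_eq_zero]
      have h3 := Algebra.trace_eq_of_algEquiv (FiniteField.frobeniusAlgEquivOfAlgebraic (ZMod p) K) z.2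
      rw [← h3]
      simp [FiniteField.coe_frobeniusAlgEquivOfAlgebraic, ZMod.card]
    · intro x hx
      let f : K[X] := X ^ p - X - C (a • x + b • x⁻¹)
      have hf : f.natDegree = p := by
        simp only [f]
        rw [natDegree_sub_C, natDegree_sub_eq_left_of_natDegree_lt] <;> simp [hp1]
      have hf0 : f ≠ 0 := by intro h0; rw [h0] at hf; simp at hf; omega
      calc _ ≤ f.roots.toFinset.card := by
            apply Finset.card_le_card_of_injOn Prod.snd
            · intro z hz
              rw [Finset.mem_coe, Finset.mem_filter] at hz
              obtain ⟨h1, h2⟩ := aux z hz.1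
              rw [hz.2] at h2
              rw [Finset.mem_coe, Multiset.mem_toFinset, mem_roots hf0]
              simp [f, IsRoot, h2]
            · intro z hz z' hz' he
              rw [Finset.mem_coe, Finset.mem_filter] at hz hz'
              exact Prod.ext (hz.2.trans hz'.2.symm) he
        _ ≤ p := by
            have := (Multiset.toFinset_card_le f.roots).trans (card_roots' f)
            omega
  have : (6 * p + 2) * p ^ m = (6 * p + 1) * p ^ m + p ^ m := by ring
  omega


open Polynomial in
/-- The completely multiplicative function on monic polynomials attached to the Kloosterman sum. -/
noncomputable def kloEta {p : ℕ} [Fact p.Prime] (a b : ZMod p) (g : (ZMod p)[X]) : ℂ :=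
  if g.coeff 0 = 0 then 0
  else ZMod.stdAddChar (-(a * g.nextCoeff + b * (g.coeff 1 / g.coeff 0)))

open Polynomial in
theorem kloEta_mul {p : ℕ} [Fact p.Prime] (a b : ZMod p) (g h : (ZMod p)[X]) (hg : g.Monic) (hh : h.Monic) :
    kloEta a b (g * h) = kloEta a b g * kloEta a b h := by
  unfold kloEta
  rw [mul_coeff_zero, mul_coeff_one, hg.nextCoeff_mul hh]
  by_cases h1 : g.coeff 0 = 0
  · simp [h1]
  by_cases h2 : h.coeff 0 = 0
  · simp [h2]
  rw [if_neg (mul_ne_zero h1 h2), if_neg h1, if_neg h2, ← AddChar.map_add_eq_mul]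
  congr 1
  field_simp
  ring

open Polynomial in
theorem kloEta_one {p : ℕ} [Fact p.Prime] (a b : ZMod p) : kloEta a b 1 = 1 := by
  unfold kloEta
  have : (1 : (ZMod p)[X]).nextCoeff = 0 := by simp [nextCoeff]
  simp [this, coeff_one]

open Polynomial in
theorem kloEta_pow {p : ℕ} [Fact p.Prime] (a b : ZMod p) (g : (ZMod p)[X]) (hg : g.Monic) (n : ℕ) :
    kloEta a b (g ^ n) = kloEta a b g ^ n := by
  induction n with
  | zero => simp [kloEta_one]
  | succ n ih => rw [pow_succ, kloEta_mul _ _ _ _ (hg.pow n) hg, ih, pow_succ]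

open Polynomial in
theorem kloM_finite (p : ℕ) [Fact p.Prime] (n : ℕ) :
    {g : (ZMod p)[X] | g.Monic ∧ g.natDegree = n}.Finite := by
  have h1 : Finite (degreeLT (ZMod p) (n+1)) := Finite.of_equiv _ (degreeLTEquiv (ZMod p) (n+1)).toEquiv.symm
  have h2 : ((degreeLT (ZMod p) (n+1) : Submodule _ _) : Set (ZMod p)[X]).Finite := h1
  refine h2.subset ?_
  rintro g ⟨hg, rfl⟩
  rw [SetLike.mem_coe, mem_degreeLT]
  exact lt_of_le_of_lt degree_le_natDegree (by exact_mod_cast Nat.lt_succ_self _)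

open Polynomial in
/-- Monic polynomials of degree n. -/
noncomputable def kloM (p : ℕ) [Fact p.Prime] (n : ℕ) : Finset (ZMod p)[X] := (kloM_finite p n).toFinset

open Polynomial in
theorem mem_kloM {p : ℕ} [Fact p.Prime] {n : ℕ} {g : (ZMod p)[X]} :
    g ∈ kloM p n ↔ g.Monic ∧ g.natDegree = n := by
  simp [kloM]

open Classical in
/-- Monic irreducible polynomials of degree n. -/
noncomputable def kloIrr (p : ℕ) [Fact p.Prime] (n : ℕ) : Finset (Polynomial (ZMod p)) :=
  (kloM p n).filter Irreducible

theorem mem_kloIrr {p : ℕ} [Fact p.Prime] {n : ℕ} {g : Polynomial (ZMod p)} :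
    g ∈ kloIrr p n ↔ (g.Monic ∧ g.natDegree = n) ∧ Irreducible g := by
  simp [kloIrr, mem_kloM]

noncomputable def kloA {p : ℕ} [Fact p.Prime] (a b : ZMod p) (n : ℕ) : ℂ :=
  ∑ g ∈ kloM p n, kloEta a b g

noncomputable def kloS {p : ℕ} [Fact p.Prime] (a b : ZMod p) (n : ℕ) : ℂ :=
  ∑ d ∈ n.divisors, ∑ P ∈ kloIrr p d, (d : ℂ) * kloEta a b P ^ (n / d)

open Polynomial in
theorem kloA_zero {p : ℕ} [Fact p.Prime] (a b : ZMod p) : kloA a b 0 = 1 := by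
  have : kloM p 0 = {1} := by
    ext g
    rw [mem_kloM, Finset.mem_singleton]
    constructor
    · rintro ⟨h1, h2⟩; exact h1.natDegree_eq_zero.1 h2
    · rintro rfl; simp
  rw [kloA, this, Finset.sum_singleton, kloEta_one]

theorem klo_sum_units {K : Type*} [Field K] [Fintype K] [DecidableEq K] (f : K → ℂ) :
    ∑ u : Kˣ, f u = ∑ x : K, if x = 0 then 0 else f x := by
  have : ∑ x : K, (if x = 0 then 0 else f x) = ∑ x ∈ Finset.univ.filter (fun x : K => x ≠ 0), f x := by
    rw [Finset.sum_filter]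
    apply Finset.sum_congr rfl
    intro x _
    by_cases hx : x = 0 <;> simp [hx]
  rw [this]
  refine Finset.sum_bij (fun u _ => (u : K)) ?_ ?_ ?_ ?_
  · intro u _; simp
  · intro u _ v _ h; exact Units.ext h
  · intro x hx
    exact ⟨Units.mk0 x (Finset.mem_filter.1 hx).2, Finset.mem_univ _, rfl⟩
  · intro u _; rfl

open Polynomial in
theorem kloA_one {p : ℕ} [Fact p.Prime] (a b : ZMod p) :
    kloA a b 1 = ∑ x : (ZMod p)ˣ, ZMod.stdAddChar (a * (x : ZMod p) + b * ((x⁻¹ : (ZMod p)ˣ) : ZMod p)) := by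
  classical
  have h1 : kloA a b 1 = ∑ x : ZMod p, kloEta a b (X - C x) := by
    symm
    unfold kloA
    refine Finset.sum_bij (fun x _ => X - C x) ?_ ?_ ?_ ?_
    · intro x _; rw [mem_kloM]; exact ⟨monic_X_sub_C x, natDegree_X_sub_C x⟩
    · intro x _ y _ h
      have := congrArg (fun f => - f.coeff 0) h
      simpa using this
    · intro g hg
      rw [mem_kloM] at hg
      refine ⟨-g.coeff 0, Finset.mem_univ _, ?_⟩
      rw [hg.1.eq_X_add_C hg.2]; simp
    · intro x _; rfl
  have h2 : ∀ x : ZMod p, kloEta a b (X - C x) = if x = 0 then 0 else ZMod.stdAddChar (a * x + b * x⁻¹) := by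
    intro x
    unfold kloEta
    by_cases hx : x = 0
    · simp [hx]
    · simp only [nextCoeff_X_sub_C]
      simp [hx]
      congr 1
      ring
  rw [h1]
  simp only [h2]
  rw [← klo_sum_units (fun x : ZMod p => (ZMod.stdAddChar (a * x + b * x⁻¹) : ℂ))]
  apply Finset.sum_congr rfl
  intro x _
  rw [Units.val_inv_eq_inv_val]

theorem klo_prim (p : ℕ) [Fact p.Prime] (t : ZMod p) : ∑ x : ZMod p, ZMod.stdAddChar (x * t) = if t = 0 then (p : ℂ) else 0 := by
  have := AddChar.sum_mulShift t (ZMod.isPrimitive_stdAddChar p)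
  rw [this, ZMod.card]
  push_cast
  rfl

open Polynomial in
theorem kloA_two {p : ℕ} [Fact p.Prime] (a b : ZMod p) (ha : a ≠ 0) (hb : b ≠ 0) : kloA a b 2 = p := by
  classical
  have h1 : kloA a b 2 = ∑ v : ZMod p, ∑ u : ZMod p, kloEta a b (X ^ 2 + C u * X + C v) := by
    symm
    unfold kloA
    rw [← Finset.sum_product']
    have hdeg : ∀ u v : ZMod p, (C u * X + C v).degree < ((2 : ℕ) : WithBot ℕ) := fun u v =>
      lt_of_le_of_lt degree_linear_le (by norm_num)
    refine Finset.sum_bij (fun x _ => X ^ 2 + C x.2 * X + C x.1) ?_ ?_ ?_ ?_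
    · intro x _; rw [mem_kloM]
      rw [add_assoc]
      refine ⟨monic_X_pow_add (hdeg _ _), ?_⟩
      compute_degree!
    · intro x _ y _ h
      have e0 := congrArg (fun f => f.coeff 0) h
      have e1 := congrArg (fun f => f.coeff 1) h
      simp [coeff_X_pow] at e0 e1
      exact Prod.ext e0 e1
    · intro g hg
      rw [mem_kloM] at hg
      refine ⟨(g.coeff 0, g.coeff 1), Finset.mem_univ _, ?_⟩
      have h3 := hg.1.as_sum
      rw [hg.2, Finset.sum_range_succ, Finset.sum_range_one] at h3
      conv_rhs => rw [h3]
      simp; ring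
    · intro x _; rfl
  have h2 : ∀ u v : ZMod p, kloEta a b (X ^ 2 + C u * X + C v) =
      if v = 0 then 0 else ZMod.stdAddChar (u * (-(a + b * v⁻¹))) := by
    intro u v
    have hn : (X ^ 2 + C u * X + C v).nextCoeff = u := by
      have hdeg : (C u * X + C v).degree < ((2 : ℕ) : WithBot ℕ) :=
        lt_of_le_of_lt degree_linear_le (by norm_num)
      have : (X ^ 2 + C u * X + C v).natDegree = 2 := by
        rw [add_assoc]; compute_degree!
      rw [nextCoeff_of_natDegree_pos (by omega), this]
      simp [coeff_X_pow]
    unfold kloEta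
    rw [hn]
    by_cases hv : v = 0
    · simp [hv]
    · simp [hv, coeff_X_pow]
      congr 1
      field_simp
  rw [h1]
  have h3 : ∀ v : ZMod p, ∑ u : ZMod p, kloEta a b (X ^ 2 + C u * X + C v) = if v = - b / a then (p : ℂ) else 0 := by
    intro v
    simp only [h2]
    by_cases hv : v = 0
    · have : ¬ (0 = -b / a) := by
        intro h; field_simp at h; exact hb (by simpa using h)
      simp [hv, this]
    · simp only [hv, if_false]
      rw [klo_prim]
      congr 1
      rw [eq_iff_iff]
      constructor
      · intro h; field_simp at h ⊢; linear_combination -h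
      · intro h; rw [h]; field_simp; ring
  simp only [h3]
  simp

open Polynomial in
theorem kloA_big {p : ℕ} [Fact p.Prime] (a b : ZMod p) (ha : a ≠ 0) (n : ℕ) : kloA a b (n + 3) = 0 := by
  have key : ∀ t : ZMod p, kloA a b (n+3) * ZMod.stdAddChar (-(a * t)) = kloA a b (n + 3) := by
    intro t
    unfold kloA
    rw [Finset.sum_mul]
    have hd : ∀ t : ZMod p, (C t * X ^ (n + 2) : (ZMod p)[X]).degree < ((n + 3 : ℕ) : WithBot ℕ) := fun t =>
      lt_of_le_of_lt (degree_C_mul_X_pow_le _ _) (by exact_mod_cast Nat.lt_succ_self _)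
    have hmem : ∀ t : ZMod p, ∀ g ∈ kloM p (n+3), g + C t * X ^ (n + 2) ∈ kloM p (n+3) := by
      intro t g hg
      rw [mem_kloM] at hg ⊢
      have : (C t * X ^ (n + 2) : (ZMod p)[X]).degree < g.degree := by
        rw [degree_eq_natDegree hg.1.ne_zero, hg.2]; exact hd t
      refine ⟨hg.1.add_of_left this, ?_⟩
      rw [natDegree_eq_of_degree_eq (degree_add_eq_left_of_degree_lt this), hg.2]
    refine Finset.sum_bij (fun g _ => g + C t * X ^ (n + 2)) (hmem t) ?_ ?_ ?_
    · intro g _ g' _ h; exact add_right_cancel h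
    · intro g hg
      refine ⟨g + C (-t) * X ^ (n + 2), hmem _ g hg, ?_⟩
      simp
    · intro g hg
      have h2 := mem_kloM.1 (hmem t g hg)
      have h1 := mem_kloM.1 hg
      unfold kloEta
      rw [nextCoeff_of_natDegree_pos (by omega), nextCoeff_of_natDegree_pos (by omega), h1.2, h2.2]
      have e0 : (g + C t * X ^ (n + 2)).coeff 0 = g.coeff 0 := by
        rw [coeff_add, coeff_C_mul_X_pow, if_neg (by omega), add_zero]
      have e1 : (g + C t * X ^ (n + 2)).coeff 1 = g.coeff 1 := by
        rw [coeff_add, coeff_C_mul_X_pow, if_neg (by omega), add_zero]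
      have e2 : (g + C t * X ^ (n + 2)).coeff (n + 3 - 1) = g.coeff (n + 3 - 1) + t := by
        rw [coeff_add, coeff_C_mul_X_pow, if_pos (by omega)]
      rw [e0, e1, e2]
      by_cases h0 : g.coeff 0 = 0
      · simp [h0]
      · rw [if_neg h0, if_neg h0, ← AddChar.map_add_eq_mul]
        congr 1
        ring
  have h1 := key (-a⁻¹)
  have h2 : ZMod.stdAddChar (-(a * -a⁻¹)) ≠ (1 : ℂ) := by
    have : -(a * -a⁻¹) = 1 := by field_simp
    rw [this]
    intro h
    have := ZMod.injective_stdAddChar (h.trans (AddChar.map_zero_eq_one _).symm)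
    exact one_ne_zero this
  by_contra hne
  apply h2
  apply mul_left_cancel₀ hne
  rw [h1, mul_one]


open Polynomial UniqueFactorizationMonoid in
theorem klo_degree_sum {p : ℕ} [Fact p.Prime] {n : ℕ} (g : (ZMod p)[X]) (hg : g ∈ kloM p n) :
    n = ∑ d ∈ Finset.Icc 1 n, ∑ P ∈ kloIrr p d, ∑ j ∈ Finset.Icc 1 n, (open Classical in if P ^ j ∣ g then d else 0) := by
  classical
  obtain ⟨hm, hdeg⟩ := mem_kloM.1 hg
  have hg0 := hm.ne_zero
  have hfac : ∀ P ∈ normalizedFactors g, P.Monic ∧ Irreducible P := by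
    intro P hP
    have h1 := normalize_normalized_factor P hP
    have h2 := irreducible_of_normalized_factor P hP
    refine ⟨?_, h2⟩
    rw [← h1]; exact monic_normalize h2.ne_zero
  have hprod : (normalizedFactors g).prod = g := by
    rw [prod_normalizedFactors_eq hg0, hm.normalize_eq_self]
  have hn : n = ((normalizedFactors g).map natDegree).sum := by
    conv_lhs => rw [← hdeg, ← hprod]
    rw [natDegree_multiset_prod_of_monic]
    intro P hP; exact (hfac P hP).1
  have hdvd : ∀ P : (ZMod p)[X], P.Monic → Irreducible P → ∀ j, (P ^ j ∣ g ↔ j ≤ (normalizedFactors g).count P) := by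
    intro P hP hi j
    rw [pow_dvd_iff_le_emultiplicity, emultiplicity_eq_count_normalizedFactors hi hg0, hP.normalize_eq_self]
    exact_mod_cast Iff.rfl
  have hcount : ∀ P : (ZMod p)[X], P.Monic → Irreducible P → 1 ≤ P.natDegree ∧ (normalizedFactors g).count P * P.natDegree ≤ n := by
    intro P hP hi
    refine ⟨hi.natDegree_pos, ?_⟩
    have := (hdvd P hP hi _).2 le_rfl
    have := natDegree_le_of_dvd this hg0
    rwa [hP.natDegree_pow, hdeg] at this
  have hinner : ∀ d ∈ Finset.Icc 1 n, ∀ P ∈ kloIrr p d,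
      ∑ j ∈ Finset.Icc 1 n, (if P ^ j ∣ g then d else 0) = (normalizedFactors g).count P * P.natDegree := by
    intro d hd P hP
    obtain ⟨⟨h1, h2⟩, h3⟩ := mem_kloIrr.1 hP
    rw [← Finset.sum_filter, Finset.sum_const, smul_eq_mul, h2]
    congr 1
    obtain ⟨h4, h5⟩ := hcount P h1 h3
    have : (Finset.Icc 1 n).filter (fun j => P ^ j ∣ g) = Finset.Icc 1 ((normalizedFactors g).count P) := by
      ext j
      rw [Finset.mem_filter, Finset.mem_Icc, Finset.mem_Icc, hdvd P h1 h3]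
      constructor
      · rintro ⟨h6, h7⟩; exact ⟨h6.1, h7⟩
      · rintro ⟨h6, h7⟩
        refine ⟨⟨h6, ?_⟩, h7⟩
        nlinarith
    rw [this, Nat.card_Icc]; simp
  rw [Finset.sum_congr rfl (fun d hd => Finset.sum_congr rfl (hinner d hd))]
  rw [Finset.sum_sigma']
  conv_lhs => rw [hn]
  rw [Finset.sum_multiset_map_count]
  simp only [smul_eq_mul]
  symm
  refine Finset.sum_bij_ne_zero (fun x _ _ => x.2) ?_ ?_ ?_ ?_
  · rintro ⟨d, P⟩ h1 h2
    rw [Multiset.mem_toFinset, ← Multiset.count_ne_zero]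
    exact (mul_ne_zero_iff.1 h2).1
  · rintro ⟨d, P⟩ h1 h2 ⟨d', P'⟩ h1' h2' h
    simp only at h
    subst h
    rw [Finset.mem_sigma] at h1 h1'
    have e1 := (mem_kloIrr.1 h1.2).1.2
    have e2 := (mem_kloIrr.1 h1'.2).1.2
    simp only at e1 e2
    rw [← e1, ← e2]
  · intro P hP h0
    rw [Multiset.mem_toFinset] at hP
    obtain ⟨h1, h3⟩ := hfac P hP
    obtain ⟨h4, h5⟩ := hcount P h1 h3
    refine ⟨⟨P.natDegree, P⟩, ?_, h0, rfl⟩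
    rw [Finset.mem_sigma, Finset.mem_Icc, mem_kloIrr]
    refine ⟨⟨h4, ?_⟩, ⟨h1, rfl⟩, h3⟩
    have := Multiset.count_pos.2 hP
    simp only
    nlinarith
  · intro x _ _; rfl

open Polynomial in
theorem klo_dvd_sum {p : ℕ} [Fact p.Prime] (a b : ZMod p) (n d j : ℕ) (P : (ZMod p)[X]) (hP : P ∈ kloIrr p d) :
    ∑ g ∈ kloM p n, (open Classical in if P ^ j ∣ g then kloEta a b g else 0) =
      if j * d ≤ n then kloEta a b P ^ j * kloA a b (n - j * d) else 0 := by
  classical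
  obtain ⟨⟨h1, h2⟩, h3⟩ := mem_kloIrr.1 hP
  have hPj : (P ^ j).natDegree = j * d := by rw [h1.natDegree_pow, h2]
  split_ifs with hle
  · rw [← Finset.sum_filter, kloA, Finset.mul_sum]
    symm
    refine Finset.sum_bij (fun k _ => P ^ j * k) ?_ ?_ ?_ ?_
    · intro k hk
      obtain ⟨h4, h5⟩ := mem_kloM.1 hk
      rw [Finset.mem_filter, mem_kloM]
      refine ⟨⟨(h1.pow j).mul h4, ?_⟩, dvd_mul_right _ _⟩
      rw [(h1.pow j).natDegree_mul h4, hPj, h5]; omega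
    · intro k _ k' _ h
      exact mul_left_cancel₀ (h1.pow j).ne_zero h
    · intro g hg
      rw [Finset.mem_filter, mem_kloM] at hg
      obtain ⟨⟨h4, h5⟩, k, rfl⟩ := hg
      have hk : k.Monic := (h1.pow j).of_mul_monic_left h4
      refine ⟨k, ?_, rfl⟩
      rw [mem_kloM]
      refine ⟨hk, ?_⟩
      rw [(h1.pow j).natDegree_mul hk, hPj] at h5
      omega
    · intro k hk
      obtain ⟨h4, h5⟩ := mem_kloM.1 hk
      rw [kloEta_mul _ _ _ _ (h1.pow j) h4, kloEta_pow _ _ _ h1]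
  · apply Finset.sum_eq_zero
    intro g hg
    obtain ⟨h4, h5⟩ := mem_kloM.1 hg
    rw [if_neg]
    intro h
    have := natDegree_le_of_dvd h h4.ne_zero
    omega

theorem klo_newton {p : ℕ} [Fact p.Prime] (a b : ZMod p) (n : ℕ) :
    (n : ℂ) * kloA a b n = ∑ m ∈ Finset.Icc 1 n, kloS a b m * kloA a b (n - m) := by
  classical
  have h1 : (n : ℂ) * kloA a b n = ∑ d ∈ Finset.Icc 1 n, ∑ P ∈ kloIrr p d, ∑ j ∈ Finset.Icc 1 n,
      (d : ℂ) * (if j * d ≤ n then kloEta a b P ^ j * kloA a b (n - j * d) else 0) := by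
    have : (n : ℂ) * kloA a b n = ∑ g ∈ kloM p n, ∑ d ∈ Finset.Icc 1 n, ∑ P ∈ kloIrr p d, ∑ j ∈ Finset.Icc 1 n,
        (d : ℂ) * (if P ^ j ∣ g then kloEta a b g else 0) := by
      rw [kloA, Finset.mul_sum]
      apply Finset.sum_congr rfl
      intro g hg
      have := congrArg (fun k : ℕ => (k : ℂ)) (klo_degree_sum g hg)
      rw [this]
      push_cast
      rw [Finset.sum_mul]
      apply Finset.sum_congr rfl; intro d _
      rw [Finset.sum_mul]
      apply Finset.sum_congr rfl; intro P _
      rw [Finset.sum_mul]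
      apply Finset.sum_congr rfl; intro j _
      split_ifs <;> simp
    rw [this, Finset.sum_comm]
    apply Finset.sum_congr rfl; intro d _
    rw [Finset.sum_comm]
    apply Finset.sum_congr rfl; intro P hP
    rw [Finset.sum_comm]
    apply Finset.sum_congr rfl; intro j _
    rw [← Finset.mul_sum]
    congr 1
    convert klo_dvd_sum a b n d j P hP
  rw [h1]
  have h2 : ∀ m, kloS a b m * kloA a b (n - m) = ∑ d ∈ m.divisors, ∑ P ∈ kloIrr p d, (d : ℂ) * (kloEta a b P ^ (m / d) * kloA a b (n - m)) := by
    intro m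
    rw [kloS, Finset.sum_mul]
    apply Finset.sum_congr rfl; intro d _
    rw [Finset.sum_mul]
    apply Finset.sum_congr rfl; intro P _
    ring
  simp only [h2]
  have h3 : ∀ d, ∑ P ∈ kloIrr p d, ∑ j ∈ Finset.Icc 1 n,
      (d : ℂ) * (if j * d ≤ n then kloEta a b P ^ j * kloA a b (n - j * d) else 0) =
      ∑ j ∈ (Finset.Icc 1 n).filter (fun j => j * d ≤ n), ∑ P ∈ kloIrr p d, (d : ℂ) * (kloEta a b P ^ j * kloA a b (n - j * d)) := by
    intro d
    rw [Finset.sum_comm, Finset.sum_filter]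
    apply Finset.sum_congr rfl; intro j _
    split_ifs <;> simp
  simp only [h3]
  rw [Finset.sum_sigma' (Finset.Icc 1 n) (fun d => (Finset.Icc 1 n).filter (fun j => j * d ≤ n)),
    Finset.sum_sigma' (Finset.Icc 1 n) (fun m => m.divisors)]
  refine Finset.sum_bij' (fun x _ => ⟨x.2 * x.1, x.1⟩) (fun y _ => ⟨y.2, y.1 / y.2⟩) ?_ ?_ ?_ ?_ ?_
  · rintro ⟨d, j⟩ h
    simp only [Finset.mem_sigma, Finset.mem_Icc, Finset.mem_filter, Nat.mem_divisors] at h ⊢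
    obtain ⟨⟨h1, h2⟩, ⟨h3, h4⟩, h5⟩ := h
    have : 1 ≤ j * d := Nat.mul_pos h3 h1
    exact ⟨⟨this, h5⟩, dvd_mul_left _ _, by omega⟩
  · rintro ⟨m, d⟩ h
    simp only [Finset.mem_sigma, Finset.mem_Icc, Finset.mem_filter, Nat.mem_divisors] at h ⊢
    obtain ⟨⟨h1, h2⟩, ⟨k, rfl⟩, h5⟩ := h
    have hd : 0 < d := Nat.pos_of_ne_zero (by rintro rfl; simp at h5)
    have hk : 0 < k := Nat.pos_of_ne_zero (by rintro rfl; simp at h5)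
    rw [Nat.mul_div_cancel_left _ hd]
    refine ⟨⟨hd, ?_⟩, ⟨hk, ?_⟩, by rw [mul_comm]; exact h2⟩ <;> nlinarith
  · rintro ⟨d, j⟩ h
    simp only [Finset.mem_sigma, Finset.mem_Icc, Finset.mem_filter] at h
    have h9 : j * d / d = j := Nat.mul_div_cancel j (by omega)
    simp only [h9]
  · rintro ⟨m, d⟩ h
    simp only [Finset.mem_sigma, Nat.mem_divisors] at h
    simp only
    rw [Nat.div_mul_cancel h.2.1]
  · rintro ⟨d, j⟩ h
    simp only [Finset.mem_sigma, Finset.mem_Icc, Finset.mem_filter] at h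
    simp only
    rw [Nat.mul_div_cancel _ (by omega)]

theorem kloS_one {p : ℕ} [Fact p.Prime] (a b : ZMod p) : kloS a b 1 = kloA a b 1 := by
  have := klo_newton a b 1
  simp [kloA_zero] at this
  exact this.symm

theorem kloS_two {p : ℕ} [Fact p.Prime] (a b : ZMod p) (ha : a ≠ 0) (hb : b ≠ 0) :
    kloS a b 2 = 2 * p - kloA a b 1 ^ 2 := by
  have := klo_newton a b 2
  rw [Finset.sum_Icc_succ_top (by norm_num), Finset.Icc_self, Finset.sum_singleton] at this
  simp [kloA_zero, kloA_two a b ha hb, kloS_one] at this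
  rw [this]; ring

theorem kloS_rec {p : ℕ} [Fact p.Prime] (a b : ZMod p) (ha : a ≠ 0) (hb : b ≠ 0) (n : ℕ) :
    kloS a b (n + 3) = - kloA a b 1 * kloS a b (n + 2) - p * kloS a b (n + 1) := by
  have := klo_newton a b (n + 3)
  rw [kloA_big a b ha, Finset.sum_Icc_succ_top (by omega), Finset.sum_Icc_succ_top (by omega),
    Finset.sum_Icc_succ_top (by omega), Finset.sum_eq_zero] at this
  · have e1 : n + 3 - (n + 1) = 2 := by omega
    have e2 : n + 3 - (n + 1 + 1) = 1 := by omega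
    have e3 : n + 3 - (n + 2 + 1) = 0 := by omega
    rw [e1, e2, e3, kloA_zero, kloA_two a b ha hb] at this
    simp only [show n + 1 + 1 = n + 2 from rfl, show n + 2 + 1 = n + 3 from rfl] at this
    linear_combination -this
  · intro m hm
    rw [Finset.mem_Icc] at hm
    obtain ⟨k, hk⟩ : ∃ k, n + 3 - m = k + 3 := ⟨n - m, by omega⟩
    rw [hk, kloA_big a b ha, mul_zero]


open Polynomial IntermediateField in
theorem klo_adjoin_inv {F K : Type*} [Field F] [Field K] [Algebra F K] (x : K) :
    F⟮x⁻¹⟯ = F⟮x⟯ := by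
  apply le_antisymm
  · rw [adjoin_simple_le_iff]
    exact inv_mem (mem_adjoin_simple_self F x)
  · rw [adjoin_simple_le_iff]
    have := inv_mem (mem_adjoin_simple_self F x⁻¹)
    rwa [inv_inv] at this

open Polynomial IntermediateField in
theorem klo_minpoly_inv {F K : Type*} [Field F] [Field K] [Algebra F K] [FiniteDimensional F K] (x : K) (hx : x ≠ 0) :
    (minpoly F x).coeff 0 ≠ 0 ∧ (minpoly F x⁻¹).nextCoeff = (minpoly F x).coeff 1 / (minpoly F x).coeff 0 := by
  have hi : IsIntegral F x := Algebra.IsIntegral.isIntegral x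
  have hi' : IsIntegral F x⁻¹ := Algebra.IsIntegral.isIntegral _
  have h0 : (minpoly F x).coeff 0 ≠ 0 := minpoly.coeff_zero_ne_zero hi hx
  refine ⟨h0, ?_⟩
  set P := minpoly F x with hP
  have hd : P.natDegree = (minpoly F x⁻¹).natDegree := by
    rw [hP, ← adjoin.finrank hi, ← adjoin.finrank hi', klo_adjoin_inv]
  have ht : P.natTrailingDegree = 0 := natTrailingDegree_eq_zero.2 (Or.inr h0)
  have hr : P.reverse.natDegree = P.natDegree := by rw [reverse_natDegree, ht, Nat.sub_zero]
  have hQd : (C (P.coeff 0)⁻¹ * P.reverse).natDegree = P.natDegree := by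
    rw [natDegree_C_mul (inv_ne_zero h0), hr]
  have hQm : (C (P.coeff 0)⁻¹ * P.reverse).Monic := by
    rw [Monic, leadingCoeff_mul, leadingCoeff_C, reverse_leadingCoeff, trailingCoeff, ht, inv_mul_cancel₀ h0]
  have hQ0 : aeval x⁻¹ (C (P.coeff 0)⁻¹ * P.reverse) = 0 := by
    rw [map_mul]
    have : aeval x⁻¹ P.reverse = 0 := by
      let _ : Invertible x := invertibleOfNonzero hx
      have := (eval₂_reverse_eq_zero_iff (algebraMap F K) x P).2 (by rw [← aeval_def]; exact minpoly.aeval F x)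
      rwa [invOf_eq_inv, ← aeval_def] at this
    rw [this, mul_zero]
  have hQ : C (P.coeff 0)⁻¹ * P.reverse = minpoly F x⁻¹ :=
    eq_of_monic_of_dvd_of_natDegree_le (minpoly.monic hi') hQm (minpoly.dvd F _ hQ0) (by rw [hQd, hd])
  have hpos : 0 < P.natDegree := minpoly.natDegree_pos hi
  rw [← hQ, nextCoeff_of_natDegree_pos (by rw [hQd]; exact hpos), hQd, coeff_C_mul, coeff_reverse,
    revAt_le (by omega)]
  rw [show P.natDegree - (P.natDegree - 1) = 1 by omega]
  field_simp

open Polynomial IntermediateField in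
theorem klo_term {p : ℕ} [Fact p.Prime] {K : Type*} [Field K] [Fintype K] [DecidableEq K] [Algebra (ZMod p) K]
    (a b : ZMod p) (x : K) :
    (if x = 0 then (0:ℂ) else ZMod.stdAddChar (Algebra.trace (ZMod p) K (a • x + b • x⁻¹))) =
      kloEta a b (minpoly (ZMod p) x) ^ (Module.finrank (ZMod p) K / (minpoly (ZMod p) x).natDegree) := by
  have hi : IsIntegral (ZMod p) x := Algebra.IsIntegral.isIntegral x
  have h1 := Module.finrank_mul_finrank (ZMod p) (ZMod p)⟮x⟯ K
  rw [adjoin.finrank hi] at h1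
  have h2 : Module.finrank (ZMod p) K / (minpoly (ZMod p) x).natDegree = Module.finrank (ZMod p)⟮x⟯ K := by
    rw [← h1, Nat.mul_div_cancel_left _ (minpoly.natDegree_pos hi)]
  have h3 : 0 < Module.finrank (ZMod p)⟮x⟯ K := Module.finrank_pos
  rw [h2]
  by_cases hx : x = 0
  · rw [if_pos hx, hx, minpoly.zero, kloEta]
    subst hx
    simp only [coeff_X_zero, if_true]
    rw [zero_pow h3.ne']
  · rw [if_neg hx]
    obtain ⟨h0, h4⟩ := klo_minpoly_inv (F := ZMod p) x hx
    rw [kloEta, if_neg h0, ← AddChar.map_nsmul_eq_pow, map_add, map_smul, map_smul,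
      trace_eq_finrank_mul_minpoly_nextCoeff, trace_eq_finrank_mul_minpoly_nextCoeff, h4, klo_adjoin_inv]
    congr 1
    simp only [smul_eq_mul, nsmul_eq_mul]
    ring

open Polynomial IntermediateField in
open Classical in
theorem klo_fiber {p : ℕ} [Fact p.Prime] {K : Type*} [Field K] [Fintype K] [Algebra (ZMod p) K] (n : ℕ)
    (hn : Fintype.card K = p ^ n) (P : (ZMod p)[X]) (hP : P.Monic) (hI : Irreducible P) (hd : P.natDegree ∣ n) :
    (Finset.univ.filter (fun x : K => minpoly (ZMod p) x = P)).card = P.natDegree := by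
  have hs : P.Separable := PerfectField.separable_of_irreducible hI
  have hspl : (map (algebraMap (ZMod p) K) P).Splits := by
    have h1 := hI.natDegree_dvd_iff_dvd_X_pow_card_pow_sub_X.1 hd
    rw [Nat.card_zmod, ← hn] at h1
    refine (FiniteField.splits_X_pow_card_sub_X p (K := K)).of_dvd ?_ (Polynomial.map_dvd _ h1)
    rw [Polynomial.map_ne_zero_iff (algebraMap (ZMod p) K).injective]
    exact FiniteField.X_pow_card_sub_X_ne_zero _ Fintype.one_lt_card
  rw [← card_rootSet_eq_natDegree hs hspl, ← Set.toFinset_card]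
  congr 1
  ext x
  simp only [Finset.mem_filter, Finset.mem_univ, true_and, Set.mem_toFinset, mem_rootSet]
  constructor
  · rintro rfl; exact ⟨hI.ne_zero, minpoly.aeval _ _⟩
  · rintro ⟨_, h⟩; exact (minpoly.eq_of_irreducible_of_monic hI h hP).symm

open Polynomial IntermediateField in
theorem klo_link {p : ℕ} [Fact p.Prime] {K : Type*} [Field K] [Fintype K] [DecidableEq K] [Algebra (ZMod p) K] (n : ℕ)
    (hn : Fintype.card K = p ^ n) (a b : ZMod p) :
    ∑ x : K, (if x = 0 then (0:ℂ) else ZMod.stdAddChar (Algebra.trace (ZMod p) K (a • x + b • x⁻¹))) =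
      kloS a b n := by
  classical
  have hfr : Module.finrank (ZMod p) K = n := by
    have := Module.card_eq_pow_finrank (K := ZMod p) (V := K)
    rw [hn, ZMod.card] at this
    exact (Nat.pow_right_injective (Fact.out : p.Prime).two_le this).symm
  have hn0 : n ≠ 0 := by rw [← hfr]; exact Module.finrank_pos.ne'
  simp only [klo_term, hfr]
  rw [kloS, ← Finset.sum_fiberwise_of_maps_to (s := Finset.univ) (t := n.divisors)
    (g := fun x : K => (minpoly (ZMod p) x).natDegree)]
  · apply Finset.sum_congr rfl
    intro d hd
    rw [← Finset.sum_fiberwise_of_maps_to (t := kloIrr p d) (g := fun x : K => minpoly (ZMod p) x)]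
    · apply Finset.sum_congr rfl
      intro P hP
      rw [mem_kloIrr] at hP
      obtain ⟨⟨h1, h2⟩, h3⟩ := hP
      have h4 := klo_fiber n hn P h1 h3 (by rw [h2]; exact Nat.dvd_of_mem_divisors hd)
      rw [h2] at h4
      rw [← h4, ← nsmul_eq_mul]
      rw [← Finset.sum_const]
      refine Finset.sum_congr ?_ ?_
      · ext x
        simp only [Finset.mem_filter, Finset.mem_univ, true_and]
        constructor
        · rintro ⟨_, h⟩; exact h
        · rintro h; exact ⟨by rw [h, h2, h4], h⟩
      · intro x hx
        simp only [Finset.mem_filter, Finset.mem_univ, true_and] at hx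
        rw [hx, h2, h4]
    · intro x hx
      simp only [Finset.mem_filter, Finset.mem_univ, true_and] at hx
      rw [mem_kloIrr]
      have hi : IsIntegral (ZMod p) x := Algebra.IsIntegral.isIntegral x
      exact ⟨⟨minpoly.monic hi, hx⟩, minpoly.irreducible hi⟩
  · intro x _
    rw [Nat.mem_divisors]
    have := minpoly.degree_dvd (K := ZMod p) (x := x) (Algebra.IsIntegral.isIntegral x)
    rw [hfr] at this
    exact ⟨this, hn0⟩


theorem klo_closed (s P : ℝ) (t : ℕ → ℝ) (h1 : t 1 = -s) (h2 : t 2 = s ^ 2 - 2 * P)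
    (hr : ∀ n, t (n + 3) = -s * t (n + 2) - P * t (n + 1)) (α β : ℂ) (hs : α + β = -s) (hp : α * β = P) (n : ℕ) :
    (t (n + 1) : ℂ) = α ^ (n + 1) + β ^ (n + 1) := by
  induction n using Nat.strong_induction_on with
  | _ n ih =>
    match n with
    | 0 => rw [h1]; push_cast; rw [← hs]; ring
    | 1 =>
      rw [h2]; push_cast; rw [← hp]
      have : (s : ℂ) = -(α + β) := by rw [hs]; ring
      rw [this]; ring
    | n + 2 =>
      rw [hr]; push_cast
      rw [ih n (by omega), ih (n + 1) (by omega), ← hp, ← hs]; ring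

theorem klo_seq (s P : ℝ) (hP : 0 < P) (t : ℕ → ℝ) (h1 : t 1 = -s) (h2 : t 2 = s ^ 2 - 2 * P)
    (hr : ∀ n, t (n + 3) = -s * t (n + 2) - P * t (n + 1)) :
    (∀ m, 1 ≤ m → -2 * P ^ m ≤ t (2 * m)) ∧
    (4 * P < s ^ 2 → ∃ lam, P < lam ∧ ∀ m, 1 ≤ m → lam ^ m ≤ t (2 * m)) := by
  rcases le_or_gt (s ^ 2) (4 * P) with h | h
  · refine ⟨?_, fun h' => absurd h' (not_lt.2 h)⟩
    intro m hm
    set r := Real.sqrt (4 * P - s ^ 2)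
    have hrr : r ^ 2 = 4 * P - s ^ 2 := Real.sq_sqrt (by linarith)
    have hrc : (r : ℂ) ^ 2 = 4 * P - s ^ 2 := by exact_mod_cast hrr
    set α : ℂ := ⟨-s / 2, r / 2⟩
    set β : ℂ := ⟨-s / 2, -(r / 2)⟩
    have hs : α + β = -s := by
      apply Complex.ext <;> simp [α, β]; try ring
    have hp : α * β = P := by
      apply Complex.ext
      · simp [α, β]; nlinarith
      · simp [α, β]; ring
    have hc := klo_closed s P t h1 h2 hr α β hs hp (2 * m - 1)
    rw [show 2 * m - 1 + 1 = 2 * m by omega] at hc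
    have hnα : ‖α‖ ^ 2 = P := by
      rw [← Complex.normSq_eq_norm_sq, Complex.normSq_apply]; simp [α]; nlinarith
    have hnβ : ‖β‖ ^ 2 = P := by
      rw [← Complex.normSq_eq_norm_sq, Complex.normSq_apply]; simp [β]; nlinarith
    have hb : |t (2 * m)| ≤ 2 * P ^ m := by
      rw [← Real.norm_eq_abs, ← Complex.norm_real, hc]
      refine (norm_add_le _ _).trans ?_
      rw [norm_pow, norm_pow, pow_mul, pow_mul, hnα, hnβ]; linarith
    have := neg_abs_le (t (2 * m))
    linarith
  · set r := Real.sqrt (s ^ 2 - 4 * P)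
    have hrr : r ^ 2 = s ^ 2 - 4 * P := Real.sq_sqrt (by linarith)
    set α : ℝ := (-s + r) / 2 with hα
    set β : ℝ := (-s - r) / 2 with hβ
    have hs : α + β = -s := by rw [hα, hβ]; ring
    have hp : α * β = P := by rw [hα, hβ]; nlinarith
    have hc : ∀ m, 1 ≤ m → t (2 * m) = (α ^ 2) ^ m + (β ^ 2) ^ m := by
      intro m hm
      have hc := klo_closed s P t h1 h2 hr α β (by exact_mod_cast hs) (by exact_mod_cast hp) (2 * m - 1)
      rw [show 2 * m - 1 + 1 = 2 * m by omega, pow_mul, pow_mul] at hc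
      exact_mod_cast hc
    have hsq : 2 * P < α ^ 2 + β ^ 2 := by
      have : α ^ 2 + β ^ 2 = (α + β) ^ 2 - 2 * (α * β) := by ring
      rw [this, hs, hp]; linarith
    constructor
    · intro m hm
      rw [hc m hm]
      have : 0 < P ^ m := by positivity
      have : 0 ≤ (α ^ 2) ^ m := by positivity
      have : 0 ≤ (β ^ 2) ^ m := by positivity
      linarith
    · intro _
      rcases le_or_gt (α ^ 2) P with h5 | h5
      · refine ⟨β ^ 2, by linarith, fun m hm => ?_⟩
        rw [hc m hm]
        have : 0 ≤ (α ^ 2) ^ m := by positivity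
        linarith
      · refine ⟨α ^ 2, h5, fun m hm => ?_⟩
        rw [hc m hm]
        have : 0 ≤ (β ^ 2) ^ m := by positivity
        linarith

theorem klo_star {N : ℕ} [NeZero N] (z : ZMod N) :
    (starRingEnd ℂ) (ZMod.stdAddChar z) = ZMod.stdAddChar (-z) := by
  have h := AddChar.map_neg_eq_conj (ZMod.stdAddChar (N := N)) z
  exact h.symm

theorem kloA_real {p : ℕ} [Fact p.Prime] (a b : ZMod p) : ∃ s : ℝ, kloA a b 1 = s := by
  have : (starRingEnd ℂ) (kloA a b 1) = kloA a b 1 := by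
    rw [kloA_one, map_sum]
    refine Fintype.sum_equiv (Equiv.neg _) _ _ ?_
    intro x
    rw [klo_star]
    simp only [Equiv.neg_apply, inv_neg, Units.val_neg]
    congr 1; ring
  obtain ⟨s, hs⟩ := Complex.conj_eq_iff_real.1 this
  exact ⟨s, hs⟩

theorem klo_sum_c {p : ℕ} [Fact p.Prime] (m : ℕ) (hp : p ≠ 2) (hm : 4 * p < p ^ m) (a b : ZMod p) (ha : a ≠ 0)
    (hb : b ≠ 0) (t : ZMod p → ℝ) (ht : ∀ c : ZMod p, c ≠ 0 → kloS (c * a) (c * b) (2 * m) = ((-t c : ℝ) : ℂ)) :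
    ∑ c ∈ Finset.univ.filter (fun c : ZMod p => c ≠ 0), t c ≤ (6 * p + 2) * (p : ℝ) ^ m := by
  classical
  have hm0 : m ≠ 0 := by
    rintro rfl
    have := (Fact.out : p.Prime).two_le
    simp at hm; omega
  let K := GaloisField p (2 * m)
  let _ : Fintype K := Fintype.ofFinite K
  have hcard : Fintype.card K = p ^ (2 * m) := by
    rw [Fintype.card_eq_nat_card]; exact GaloisField.card p (2 * m) (by omega)
  have h1 := klo_count (K := K) p m hp (by rw [hcard, ← pow_mul, mul_comm]) hm a b ha hb
  set N := (Finset.univ.filter (fun x : K => x ≠ 0 ∧ Algebra.trace (ZMod p) K (a • x + b • x⁻¹) = 0)).card with hN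
  have h2 : ∑ c : ZMod p, kloS (c * a) (c * b) (2 * m) = p * N := by
    simp only [← klo_link (K := K) (2 * m) hcard]
    rw [Finset.sum_comm]
    have : ∀ x : K, ∑ c : ZMod p, (if x = 0 then (0:ℂ) else
        ZMod.stdAddChar (Algebra.trace (ZMod p) K ((c * a) • x + (c * b) • x⁻¹))) =
        if x ≠ 0 ∧ Algebra.trace (ZMod p) K (a • x + b • x⁻¹) = 0 then (p : ℂ) else 0 := by
      intro x
      by_cases hx : x = 0
      · simp [hx]
      · simp only [hx, if_false, ne_eq, not_false_eq_true, true_and]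
        rw [← klo_prim]
        apply Finset.sum_congr rfl
        intro c _
        congr 1
        rw [mul_smul, mul_smul, ← smul_add, map_smul, smul_eq_mul]
    simp only [this]
    rw [← Finset.sum_filter, Finset.sum_const, nsmul_eq_mul, mul_comm]
  have h3 : kloS (0 : ZMod p) 0 (2 * m) = (p : ℂ) ^ (2 * m) - 1 := by
    rw [← klo_link (K := K) (2 * m) hcard]
    simp only [zero_smul, add_zero, map_zero, AddChar.map_zero_eq_one]
    have : ∀ x : K, (if x = 0 then (0:ℂ) else 1) = 1 - if x = 0 then 1 else 0 := by
      intro x; split_ifs <;> simp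
    simp only [this]
    rw [Finset.sum_sub_distrib]
    simp [hcard]
  have h4 : ∑ c : ZMod p, kloS (c * a) (c * b) (2 * m) = ((p : ℂ) ^ (2 * m) - 1) +
      ∑ c ∈ Finset.univ.filter (fun c : ZMod p => c ≠ 0), ((-t c : ℝ) : ℂ) := by
    rw [← Finset.add_sum_erase _ _ (Finset.mem_univ (0 : ZMod p))]
    simp only [zero_mul, h3]
    congr 1
    refine Finset.sum_congr ?_ ?_
    · ext; simp
    · intro c hc
      exact ht c (by simpa using hc)
  rw [h2] at h4
  have h5 : (p : ℝ) * N = ((p : ℝ) ^ (2 * m) - 1) +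
      ∑ c ∈ Finset.univ.filter (fun c : ZMod p => c ≠ 0), (-t c) := by exact_mod_cast h4
  rw [Finset.sum_neg_distrib] at h5
  rw [hcard] at h1
  have h6 : (p : ℝ) ^ (2 * m) ≤ p * N + (6 * p + 2) * (p : ℝ) ^ m := by exact_mod_cast h1
  linarith

theorem klo_prime_weil {p : ℕ} [Fact p.Prime] (hp : p ≠ 2) (a b : ZMod p) (ha : a ≠ 0) (hb : b ≠ 0) :
    ‖∑ x : (ZMod p)ˣ, ZMod.stdAddChar (a * (x : ZMod p) + b * ((x⁻¹ : (ZMod p)ˣ) : ZMod p))‖ ≤ 2 * Real.sqrt p := by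
  rw [← kloA_one]
  have hpp : (0 : ℝ) < p := by exact_mod_cast (Fact.out : p.Prime).pos
  have hp1 : (1 : ℝ) < p := by exact_mod_cast (Fact.out : p.Prime).one_lt
  choose s hs using fun c : ZMod p => kloA_real (c * a) (c * b)
  -- real sequence
  have key : ∀ c : ZMod p, c ≠ 0 → ∃ t : ℕ → ℝ, (∀ n, kloS (c * a) (c * b) (n + 1) = ((-t (n + 1) : ℝ) : ℂ)) ∧
      t 1 = -s c ∧ t 2 = s c ^ 2 - 2 * p ∧ ∀ n, t (n + 3) = -s c * t (n + 2) - p * t (n + 1) := by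
    intro c hc
    have hca := mul_ne_zero hc ha
    have hcb := mul_ne_zero hc hb
    have hre : ∀ n, ∃ r : ℝ, kloS (c * a) (c * b) (n + 1) = r := by
      intro n
      induction n using Nat.strong_induction_on with
      | _ n ih =>
        match n with
        | 0 => exact ⟨s c, by rw [zero_add, kloS_one, hs]⟩
        | 1 => exact ⟨2 * p - s c ^ 2, by rw [kloS_two _ _ hca hcb, hs]; push_cast; ring⟩
        | n + 2 =>
          obtain ⟨r1, h1⟩ := ih n (by omega)
          obtain ⟨r2, h2⟩ := ih (n + 1) (by omega)
          refine ⟨-s c * r2 - p * r1, ?_⟩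
          rw [kloS_rec _ _ hca hcb, h1, h2, hs]; push_cast; ring
    choose r hr using hre
    have h1 := hr 0
    have h2 := hr 1
    simp only [zero_add] at h1
    rw [kloS_one, hs] at h1
    rw [kloS_two _ _ hca hcb, hs] at h2
    refine ⟨fun n => -r (n - 1), fun n => by simp [hr], ?_, ?_, ?_⟩
    · have : s c = r 0 := by exact_mod_cast h1
      simp [this]
    · have : 2 * (p : ℝ) - s c ^ 2 = r 1 := by exact_mod_cast h2
      simp only [Nat.add_one_sub_one, ← this]; ring
    · intro n
      have h3 := kloS_rec (c * a) (c * b) hca hcb n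
      rw [show n + 3 = (n + 2) + 1 by ring, show n + 2 = (n + 1) + 1 by ring, hr, hr, hr, hs] at h3
      have h4 : r (n + 1 + 1) = -s c * r (n + 1) - p * r n := by exact_mod_cast h3
      simp only [show n + 3 - 1 = n + 1 + 1 by omega, show n + 2 - 1 = n + 1 by omega, Nat.add_sub_cancel, h4]
      ring
  choose! t ht0 ht1 ht2 ht3 using key
  have hone : kloA a b 1 = s 1 := by rw [← hs, one_mul, one_mul]
  rw [hone, Complex.norm_real, Real.norm_eq_abs]
  by_contra! hcon
  have hbig : 4 * (p : ℝ) < s 1 ^ 2 := by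
    rw [← sq_abs]
    have h0 : 0 ≤ Real.sqrt p := Real.sqrt_nonneg _
    have h1 : Real.sqrt p ^ 2 = p := Real.sq_sqrt hpp.le
    nlinarith
  obtain ⟨lam, hlam, hl⟩ := (klo_seq (s 1) p hpp (t 1) (ht1 1 one_ne_zero) (ht2 1 one_ne_zero) (ht3 1 one_ne_zero)).2 hbig
  have hbound : ∀ m, 4 * p < p ^ m → lam ^ m ≤ (8 * p + 2) * (p : ℝ) ^ m := by
    intro m hm
    have hm0 : 1 ≤ m := by
      rcases Nat.eq_zero_or_pos m with rfl | h
      · have := (Fact.out : p.Prime).two_le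
        simp at hm; omega
      · exact h
    have h1 := klo_sum_c m hp hm a b ha hb (fun c => t c (2 * m)) (by
      intro c hc
      have := ht0 c hc (2 * m - 1)
      rwa [show 2 * m - 1 + 1 = 2 * m by omega] at this)
    have hmem : (1 : ZMod p) ∈ Finset.univ.filter (fun c : ZMod p => c ≠ 0) := by simp
    rw [← Finset.add_sum_erase _ _ hmem] at h1
    have h2 : ∑ c ∈ (Finset.univ.filter (fun c : ZMod p => c ≠ 0)).erase 1, (-2 * (p : ℝ) ^ m) ≤
        ∑ c ∈ (Finset.univ.filter (fun c : ZMod p => c ≠ 0)).erase 1, t c (2 * m) := by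
      apply Finset.sum_le_sum
      intro c hc
      have hc' : c ≠ 0 := by simp at hc; exact hc.2
      exact (klo_seq (s c) p hpp (t c) (ht1 c hc') (ht2 c hc') (ht3 c hc')).1 m hm0
    rw [Finset.sum_const, nsmul_eq_mul] at h2
    have h3 : (((Finset.univ.filter (fun c : ZMod p => c ≠ 0)).erase 1).card : ℝ) ≤ p := by
      have := Finset.card_le_univ ((Finset.univ.filter (fun c : ZMod p => c ≠ 0)).erase 1)
      rw [ZMod.card] at this
      exact_mod_cast this
    have h4 := hl m hm0
    have h5 : (0 : ℝ) < (p : ℝ) ^ m := by positivity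
    nlinarith
  have hratio : 1 < lam / p := by rw [one_lt_div hpp]; exact hlam
  obtain ⟨m1, hm1⟩ := pow_unbounded_of_one_lt (8 * (p : ℝ) + 2) hratio
  obtain ⟨m2, hm2⟩ := pow_unbounded_of_one_lt (4 * (p : ℝ)) hp1
  have h7 : 4 * p < p ^ (max m1 m2) := by
    have : (4 * p : ℝ) < (p : ℝ) ^ (max m1 m2) := lt_of_lt_of_le hm2 (pow_le_pow_right₀ hp1.le (le_max_right _ _))
    exact_mod_cast this
  have h8 := hbound _ h7
  have h9 : 8 * (p : ℝ) + 2 < (lam / p) ^ (max m1 m2) :=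
    lt_of_lt_of_le hm1 (pow_le_pow_right₀ hratio.le (le_max_left _ _))
  rw [div_pow, lt_div_iff₀ (by positivity)] at h9
  linarith


/-- Kloosterman sums. -/
noncomputable def kloK (N : ℕ) [NeZero N] (a b : ZMod N) : ℂ :=
  ∑ x : (ZMod N)ˣ, ZMod.stdAddChar (a * (x : ZMod N) + b * ((x⁻¹ : (ZMod N)ˣ) : ZMod N))

theorem klo_norm_char {N : ℕ} [NeZero N] (z : ZMod N) : ‖(ZMod.stdAddChar z : ℂ)‖ = 1 :=
  AddChar.norm_apply _ _

theorem klo_prim' {N : ℕ} [NeZero N] (t : ZMod N) :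
    ∑ x : ZMod N, (ZMod.stdAddChar (x * t) : ℂ) = if t = 0 then (N : ℂ) else 0 := by
  rw [AddChar.sum_mulShift t (ZMod.isPrimitive_stdAddChar N), ZMod.card]
  simp

theorem kloK_trivial (N : ℕ) [NeZero N] (a b : ZMod N) : ‖kloK N a b‖ ≤ N.totient := by
  rw [kloK, ← ZMod.card_units_eq_totient]
  refine (norm_sum_le _ _).trans ?_
  simp

open Classical in
/-- Stationary points. -/
noncomputable def kloT (N : ℕ) [NeZero N] (e a b : ZMod N) : Finset (ZMod N)ˣ :=
  Finset.univ.filter (fun x => e * (a * (x : ZMod N) - b * ((x⁻¹ : (ZMod N)ˣ) : ZMod N)) = 0)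

theorem kloK_eq_T (N : ℕ) [NeZero N] (e a b : ZMod N) (he : e * e = 0) :
    kloK N a b = ∑ x ∈ kloT N e a b, ZMod.stdAddChar (a * (x : ZMod N) + b * ((x⁻¹ : (ZMod N)ˣ) : ZMod N)) := by
  have hN : (N : ℂ) ≠ 0 := by exact_mod_cast NeZero.ne N
  let u : ZMod N → (ZMod N)ˣ := fun z => ⟨1 + e * z, 1 - e * z, by linear_combination (-z^2) * he, by linear_combination (-z^2) * he⟩
  have h1 : ∀ z : ZMod N, kloK N a b = ∑ x : (ZMod N)ˣ,
      ZMod.stdAddChar (a * (x : ZMod N) + b * ((x⁻¹ : (ZMod N)ˣ) : ZMod N)) *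
      ZMod.stdAddChar (z * (e * (a * (x : ZMod N) - b * ((x⁻¹ : (ZMod N)ˣ) : ZMod N)))) := by
    intro z
    rw [kloK]
    refine Fintype.sum_equiv (Equiv.mulRight (u z)).symm _ _ ?_
    intro x
    obtain ⟨y, rfl⟩ := (Equiv.mulRight (u z)).surjective x
    rw [Equiv.symm_apply_apply, ← AddChar.map_add_eq_mul]
    simp only [Equiv.coe_mulRight, mul_inv, Units.val_mul]
    have h2 : ((u z)⁻¹ : (ZMod N)ˣ).val = 1 - e * z := rfl
    have h3 : (u z).val = 1 + e * z := rfl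
    rw [h2, h3]
    congr 1; ring
  have h2 : ∑ z : ZMod N, kloK N a b = N * ∑ x ∈ kloT N e a b, ZMod.stdAddChar (a * (x : ZMod N) + b * ((x⁻¹ : (ZMod N)ˣ) : ZMod N)) := by
    rw [Finset.sum_congr rfl (fun z _ => h1 z), Finset.sum_comm]
    simp only [← Finset.mul_sum, klo_prim']
    rw [kloT, Finset.sum_filter, Finset.mul_sum]
    apply Finset.sum_congr rfl
    intro x _
    split_ifs <;> ring
  rw [Finset.sum_const, nsmul_eq_mul, Finset.card_univ, ZMod.card] at h2
  exact mul_left_cancel₀ hN h2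

theorem kloK_le_T (N : ℕ) [NeZero N] (e a b : ZMod N) (he : e * e = 0) :
    ‖kloK N a b‖ ≤ (kloT N e a b).card := by
  rw [kloK_eq_T N e a b he]
  refine (norm_sum_le _ _).trans ?_
  simp

open Classical in
theorem klo_gauss (N : ℕ) [NeZero N] (A B : ZMod N) (M : ℕ)
    (hM : (Finset.univ.filter (fun v : ZMod N => 2 * B * v = 0)).card ≤ M) :
    ‖∑ z : ZMod N, (ZMod.stdAddChar (A * z + B * z ^ 2) : ℂ)‖ ^ 2 ≤ N * M := by
  set W := ∑ z : ZMod N, (ZMod.stdAddChar (A * z + B * z ^ 2) : ℂ) with hW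
  have h1 : W * (starRingEnd ℂ) W = ∑ v : ZMod N, ZMod.stdAddChar (A * v + B * v ^ 2) *
      (if 2 * B * v = 0 then (N : ℂ) else 0) := by
    have h2 : ∀ v : ZMod N, ZMod.stdAddChar (A * v + B * v ^ 2) * (if 2 * B * v = 0 then (N : ℂ) else 0) =
        ∑ w : ZMod N, ZMod.stdAddChar (A * (v + w) + B * (v + w) ^ 2) * ZMod.stdAddChar (-(A * w + B * w ^ 2)) := by
      intro v
      rw [← klo_prim', Finset.mul_sum]
      apply Finset.sum_congr rfl
      intro w _
      rw [← AddChar.map_add_eq_mul, ← AddChar.map_add_eq_mul]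
      congr 1; ring
    simp only [h2]
    rw [Finset.sum_comm, hW, map_sum, Finset.mul_sum]
    apply Finset.sum_congr rfl
    intro w _
    rw [klo_star, ← Finset.sum_mul]
    congr 1
    exact (Fintype.sum_equiv (Equiv.addRight w) _ _ (fun v => rfl)).symm
  have h3 : ‖W‖ ^ 2 = ‖W * (starRingEnd ℂ) W‖ := by
    rw [norm_mul, RCLike.norm_conj, sq]
  rw [h3, h1]
  refine (norm_sum_le _ _).trans ?_
  have h4 : ∀ v : ZMod N, ‖(ZMod.stdAddChar (A * v + B * v ^ 2) : ℂ) * (if 2 * B * v = 0 then (N : ℂ) else 0)‖ =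
      if 2 * B * v = 0 then (N : ℝ) else 0 := by
    intro v
    rw [norm_mul, klo_norm_char, one_mul]
    split_ifs <;> simp
  simp only [h4]
  rw [← Finset.sum_filter, Finset.sum_const, nsmul_eq_mul, mul_comm]
  gcongr

open Classical in
theorem kloK_le_T' (N : ℕ) [NeZero N] (e π a b : ZMod N) (he : e * e * π = 0) (he3 : e * e * e = 0)
    (hππ : (e * π) * (e * π) = 0) (C : ℝ) (hC : 0 ≤ C) (M : ℕ)
    (hM : ∀ x : (ZMod N)ˣ, (Finset.univ.filter (fun v : ZMod N => 2 * (b * x * (e * e)) * v = 0)).card ≤ M)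
    (hCM : (M : ℝ) ≤ N * C ^ 2) :
    ‖kloK N a b‖ ≤ (kloT N (e * π) a b).card * C := by
  have hN : (0 : ℝ) < N := by exact_mod_cast NeZero.pos N
  let u : ZMod N → (ZMod N)ˣ := fun z => ⟨1 + e * z, 1 - e * z + e * e * z ^ 2,
    by linear_combination (z^3) * he3, by linear_combination (z^3) * he3⟩
  have huv : ∀ z, (u z).val = 1 + e * z := fun _ => rfl
  have hui : ∀ z, ((u z)⁻¹ : (ZMod N)ˣ).val = 1 - e * z + e * e * z ^ 2 := fun _ => rfl
  set T := kloT N (e * π) a b with hT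
  have hinv : ∀ z x, x * u z ∈ T ↔ x ∈ T := by
    intro z x
    simp only [hT, kloT, Finset.mem_filter, Finset.mem_univ, true_and, mul_inv, Units.val_mul, huv, hui]
    rw [show e * π * (a * (↑x * (1 + e * z)) - b * (((x⁻¹ : (ZMod N)ˣ) : ZMod N) * (1 - e * z + e * e * z ^ 2))) =
      e * π * (a * (x : ZMod N) - b * ((x⁻¹ : (ZMod N)ˣ) : ZMod N)) by
        linear_combination (z * (a * (x : ZMod N) + b * ((x⁻¹ : (ZMod N)ˣ) : ZMod N)) - e * z ^ 2 * b * ((x⁻¹ : (ZMod N)ˣ) : ZMod N)) * he]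
  have h1 : ∀ z : ZMod N, kloK N a b = ∑ x ∈ T,
      ZMod.stdAddChar (a * (x : ZMod N) + b * ((x⁻¹ : (ZMod N)ˣ) : ZMod N)) *
      ZMod.stdAddChar ((e * (a * (x : ZMod N) - b * ((x⁻¹ : (ZMod N)ˣ) : ZMod N))) * z +
        (b * ((x⁻¹ : (ZMod N)ˣ) : ZMod N) * (e * e)) * z ^ 2) := by
    intro z
    rw [kloK_eq_T N (e * π) a b hππ]
    symm
    refine Finset.sum_equiv (Equiv.mulRight (u z)) (fun x => (hinv z x).symm) ?_
    intro x _
    rw [← AddChar.map_add_eq_mul]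
    simp only [Equiv.coe_mulRight, mul_inv, Units.val_mul, huv, hui]
    congr 1; ring
  have h2 : (N : ℂ) * kloK N a b = ∑ x ∈ T,
      ZMod.stdAddChar (a * (x : ZMod N) + b * ((x⁻¹ : (ZMod N)ˣ) : ZMod N)) *
      ∑ z : ZMod N, ZMod.stdAddChar ((e * (a * (x : ZMod N) - b * ((x⁻¹ : (ZMod N)ˣ) : ZMod N))) * z +
        (b * ((x⁻¹ : (ZMod N)ˣ) : ZMod N) * (e * e)) * z ^ 2) := by
    have : (N : ℂ) * kloK N a b = ∑ z : ZMod N, kloK N a b := by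
      rw [Finset.sum_const, nsmul_eq_mul, Finset.card_univ, ZMod.card]
    rw [this, Finset.sum_congr rfl (fun z _ => h1 z), Finset.sum_comm]
    simp only [Finset.mul_sum]
  have h3 : N * ‖kloK N a b‖ ≤ ∑ x ∈ T, N * C := by
    have : N * ‖kloK N a b‖ = ‖(N : ℂ) * kloK N a b‖ := by rw [norm_mul, Complex.norm_natCast]
    rw [this, h2]
    refine (norm_sum_le _ _).trans (Finset.sum_le_sum ?_)
    intro x _
    rw [norm_mul, klo_norm_char, one_mul]
    have h4 := klo_gauss N (e * (a * (x : ZMod N) - b * ((x⁻¹ : (ZMod N)ˣ) : ZMod N)))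
      (b * ((x⁻¹ : (ZMod N)ˣ) : ZMod N) * (e * e)) M (hM x⁻¹)
    refine le_of_sq_le_sq ?_ (by positivity)
    refine h4.trans ?_
    nlinarith
  rw [Finset.sum_const, nsmul_eq_mul] at h3
  have h5 : N * ‖kloK N a b‖ ≤ N * (T.card * C) := by linarith
  exact le_of_mul_le_mul_left h5 hN

open Classical in
theorem klo_tors (N : ℕ) [NeZero N] (d : ℕ) (hd : 0 < d) :
    (Finset.univ.filter (fun v : ZMod N => (d : ZMod N) * v = 0)).card ≤ d := by
  have := IsAddCyclic.card_nsmul_eq_zero_le (α := ZMod N) hd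
  simpa [nsmul_eq_mul] using this

theorem klo_unit_or {p k : ℕ} [Fact p.Prime] [NeZero (p ^ k)] (z : ZMod (p ^ k)) :
    IsUnit z ∨ ∃ w : ZMod (p ^ k), z = p * w := by
  by_cases h : p ∣ z.val
  · right
    obtain ⟨w, hw⟩ := h
    refine ⟨w, ?_⟩
    rw [← ZMod.natCast_zmod_val z, hw]; push_cast; rfl
  · left
    rw [← ZMod.natCast_zmod_val z, ZMod.isUnit_iff_coprime]
    exact (((Fact.out : p.Prime).coprime_iff_not_dvd.2 h).symm).pow_right k

theorem klo_not_unit {p k : ℕ} [Fact p.Prime] (hk : k ≠ 0) (w : ZMod (p ^ k)) : ¬ IsUnit ((p : ZMod (p ^ k)) * w) := by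
  intro h
  have h1 : IsUnit ((p : ℕ) : ZMod (p ^ k)) := isUnit_of_mul_isUnit_left h
  rw [ZMod.isUnit_iff_coprime] at h1
  have h2 := Nat.Coprime.coprime_dvd_right (dvd_pow_self p hk) h1
  rw [Nat.coprime_self] at h2
  exact (Fact.out : p.Prime).one_lt.ne' h2

open Classical in
theorem klo_T_card {N : ℕ} [NeZero N] (T : Finset (ZMod N)ˣ) (x₀ : ZMod N) (d : ℕ) (hd : 0 < d)
    (h : ∀ x ∈ T, (d : ZMod N) * ((x : ZMod N) - x₀) = 0 ∨ (d : ZMod N) * ((x : ZMod N) + x₀) = 0) :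
    T.card ≤ 2 * d := by
  set V := Finset.univ.filter (fun v : ZMod N => (d : ZMod N) * v = 0) with hV
  have hVc : V.card ≤ d := klo_tors N d hd
  have h1 : T.image Units.val ⊆ V.image (fun v => v + x₀) ∪ V.image (fun v => v - x₀) := by
    intro y hy
    rw [Finset.mem_image] at hy
    obtain ⟨x, hx, rfl⟩ := hy
    rw [Finset.mem_union, Finset.mem_image, Finset.mem_image]
    rcases h x hx with h | h
    · left; exact ⟨x - x₀, by simp [hV, h], by ring⟩
    · right; exact ⟨x + x₀, by simp [hV, h], by ring⟩
  rw [← Finset.card_image_of_injective T (Units.val_injective)]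
  refine (Finset.card_le_card h1).trans ((Finset.card_union_le _ _).trans ?_)
  have h2 : (V.image (fun v => v + x₀)).card ≤ V.card := Finset.card_image_le
  have h3 : (V.image (fun v => v - x₀)).card ≤ V.card := Finset.card_image_le
  omega

theorem klo_T_units {p k l : ℕ} [Fact p.Prime] [NeZero (p ^ k)] (hlk : l < k) (a b : ZMod (p ^ k))
    (hab : IsUnit a ∨ IsUnit b) (x : (ZMod (p ^ k))ˣ) (hx : x ∈ kloT (p ^ k) ((p ^ l : ℕ) : ZMod (p ^ k)) a b) :
    IsUnit a ∧ IsUnit b := by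
  simp only [kloT, Finset.mem_filter, Finset.mem_univ, true_and] at hx
  have hz : ∀ z : ZMod (p ^ k), ((p ^ l : ℕ) : ZMod (p ^ k)) * z = 0 → ∃ w, z = p * w := by
    intro z h
    rcases klo_unit_or z with h1 | h1
    · exfalso
      rw [h1.mul_left_eq_zero, ZMod.natCast_eq_zero_iff, Nat.pow_dvd_pow_iff_le_right (Fact.out : p.Prime).one_lt] at h
      omega
    · exact h1
  obtain ⟨w, hw⟩ := hz _ hx
  have hxx : ((x : ZMod (p ^ k))) * ((x⁻¹ : (ZMod (p ^ k))ˣ) : ZMod (p ^ k)) = 1 := by simp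
  have hk : k ≠ 0 := by omega
  constructor
  · rcases klo_unit_or a with h | ⟨a', rfl⟩
    · exact h
    · exfalso
      have hb : IsUnit b := hab.resolve_left (klo_not_unit hk a')
      refine klo_not_unit hk ((a' * (x : ZMod (p ^ k)) - w) * (x : ZMod (p ^ k))) ?_
      convert hb using 1
      linear_combination (x : ZMod (p^k)) * hw + b * hxx
  · rcases klo_unit_or b with h | ⟨b', rfl⟩
    · exact h
    · exfalso
      have hb : IsUnit a := hab.resolve_right (klo_not_unit hk b')
      refine klo_not_unit hk ((b' * ((x⁻¹ : (ZMod (p ^ k))ˣ) : ZMod (p ^ k)) + w) * ((x⁻¹ : (ZMod (p ^ k))ˣ) : ZMod (p ^ k))) ?_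
      convert hb using 1
      linear_combination (-((x⁻¹ : (ZMod (p ^ k))ˣ) : ZMod (p ^ k))) * hw + (a) * hxx

theorem klo_T_sq {N : ℕ} [NeZero N] (e a b : ZMod N) (ha : IsUnit a) (x y : (ZMod N)ˣ)
    (hx : x ∈ kloT N e a b) (hy : y ∈ kloT N e a b) : e * ((x : ZMod N) - y) * (x + y) = 0 := by
  simp only [kloT, Finset.mem_filter, Finset.mem_univ, true_and] at hx hy
  have hxx : ((x : ZMod N)) * ((x⁻¹ : (ZMod N)ˣ) : ZMod N) = 1 := by simp
  have hyy : ((y : ZMod N)) * ((y⁻¹ : (ZMod N)ˣ) : ZMod N) = 1 := by simp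
  rw [← ha.mul_left_eq_zero]
  linear_combination (x : ZMod N) * hx - (y : ZMod N) * hy + (e * b) * hxx - e * b * hyy

theorem klo_T_odd {p k l : ℕ} [Fact p.Prime] (hp : p ≠ 2) [NeZero (p ^ k)] (hlk : l < k) (a b : ZMod (p ^ k))
    (hab : IsUnit a ∨ IsUnit b) : (kloT (p ^ k) ((p ^ l : ℕ) : ZMod (p ^ k)) a b).card ≤ 2 * p ^ l := by
  rcases Finset.eq_empty_or_nonempty (kloT (p ^ k) ((p ^ l : ℕ) : ZMod (p ^ k)) a b) with h | ⟨x₀, hx₀⟩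
  · rw [h]; simp
  obtain ⟨ha, _⟩ := klo_T_units hlk a b hab x₀ hx₀
  refine klo_T_card _ (x₀ : ZMod (p ^ k)) _ (pow_pos (Fact.out : p.Prime).pos _) ?_
  intro x hx
  have h1 := klo_T_sq _ a b ha x x₀ hx hx₀
  rcases klo_unit_or ((x : ZMod (p ^ k)) + (x₀ : ZMod (p ^ k))) with h | ⟨w, hw⟩
  · left; rwa [h.mul_left_eq_zero] at h1
  rcases klo_unit_or ((x : ZMod (p ^ k)) - (x₀ : ZMod (p ^ k))) with h | ⟨w', hw'⟩
  · right
    rw [mul_right_comm] at h1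
    rwa [h.mul_left_eq_zero] at h1
  exfalso
  have h2 : IsUnit (2 : ZMod (p ^ k)) := by
    have : IsUnit ((2 : ℕ) : ZMod (p ^ k)) := by
      rw [ZMod.isUnit_iff_coprime]
      exact ((Nat.coprime_primes Nat.prime_two Fact.out).2 (Ne.symm hp)).pow_right k
    exact_mod_cast this
  refine klo_not_unit (by omega : k ≠ 0) (w - w') ?_
  convert h2.mul x₀.isUnit using 1
  linear_combination hw' - hw

theorem klo_T_two {k l : ℕ} [NeZero (2 ^ k)] (hlk : l < k) (a b : ZMod (2 ^ k))
    (hab : IsUnit a ∨ IsUnit b) : (kloT (2 ^ k) ((2 ^ l : ℕ) : ZMod (2 ^ k)) a b).card ≤ 4 * 2 ^ l := by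
  have : Fact (Nat.Prime 2) := ⟨Nat.prime_two⟩
  rcases Finset.eq_empty_or_nonempty (kloT (2 ^ k) ((2 ^ l : ℕ) : ZMod (2 ^ k)) a b) with h | ⟨x₀, hx₀⟩
  · rw [h]; simp
  obtain ⟨ha, _⟩ := klo_T_units hlk a b hab x₀ hx₀
  have hpar : ∀ x : (ZMod (2 ^ k))ˣ, ∃ u : ZMod (2 ^ k), (x : ZMod (2 ^ k)) = 1 + 2 * u := by
    intro x
    have h0 := ZMod.natCast_zmod_val (x : ZMod (2 ^ k))
    rcases Nat.even_or_odd' (x : ZMod (2 ^ k)).val with ⟨w, hw | hw⟩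
    · exfalso
      rw [hw] at h0
      apply klo_not_unit (p := 2) (by omega : k ≠ 0) (w : ZMod (2 ^ k))
      have := x.isUnit
      rw [← h0] at this
      exact_mod_cast this
    · refine ⟨w, ?_⟩
      rw [← h0, hw]; push_cast; ring
  have : (kloT (2 ^ k) ((2 ^ l : ℕ) : ZMod (2 ^ k)) a b).card ≤ 2 * 2 ^ (l + 1) := by
    refine klo_T_card _ (x₀ : ZMod (2 ^ k)) _ (by positivity) ?_
    intro x hx
    have h1 := klo_T_sq _ a b ha x x₀ hx hx₀
    obtain ⟨u, hu⟩ := hpar x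
    obtain ⟨v, hv⟩ := hpar x₀
    have hxu := x.isUnit
    rw [hu, hv] at h1
    rw [hu] at hxu ⊢
    rw [hv]
    push_cast at h1 ⊢
    rcases klo_unit_or (u - v) with h | ⟨w, hw⟩
    · right
      rw [← h.mul_left_eq_zero]
      linear_combination h1
    rcases klo_unit_or (u + v + 1) with h | ⟨w', hw'⟩
    · left
      rw [← h.mul_left_eq_zero]
      linear_combination h1
    exfalso
    refine klo_not_unit (by omega : k ≠ 0) (w + w') ?_
    convert hxu using 1
    linear_combination -hw - hw'
  rw [pow_succ] at this
  omega



theorem klo_pp_one {p : ℕ} [Fact p.Prime] (a b : ZMod p) (hab : IsUnit a ∨ IsUnit b) :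
    ‖kloK p a b‖ ≤ 2 * Real.sqrt p := by
  have hp1 : (1 : ℝ) ≤ p := by exact_mod_cast (Fact.out : p.Prime).one_lt.le
  have hs1 : 1 ≤ Real.sqrt p := by rwa [Real.one_le_sqrt]
  by_cases hp : p = 2
  · have := kloK_trivial p a b
    rw [Nat.totient_prime Fact.out] at this
    have h2 : ((p - 1 : ℕ) : ℝ) = 1 := by subst hp; norm_num
    rw [h2] at this
    linarith
  have hram : ∀ c : ZMod p, c ≠ 0 → ∑ x : (ZMod p)ˣ, (ZMod.stdAddChar (c * (x : ZMod p)) : ℂ) = -1 := by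
    intro c hc
    have h1 := klo_sum_units (K := ZMod p) (fun x => (ZMod.stdAddChar (c * x) : ℂ))
    rw [h1]
    have h2 : ∀ x : ZMod p, (if x = 0 then (0 : ℂ) else ZMod.stdAddChar (c * x)) =
        ZMod.stdAddChar (x * c) - if x = 0 then 1 else 0 := by
      intro x
      split_ifs with h
      · simp [h]
      · rw [mul_comm]; simp
    simp only [h2]
    rw [Finset.sum_sub_distrib, klo_prim, if_neg hc]
    simp
  by_cases ha : a = 0
  · have hb : b ≠ 0 := by
      rcases hab with h | h
      · exact absurd ha h.ne_zero
      · exact h.ne_zero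
    have : kloK p a b = -1 := by
      rw [kloK, ← hram b hb, ha]
      refine Fintype.sum_equiv (Equiv.inv _) _ _ ?_
      intro x; simp only [Equiv.inv_apply, zero_mul, zero_add]
    rw [this, norm_neg, norm_one]; linarith
  by_cases hb : b = 0
  · have : kloK p a b = -1 := by
      rw [kloK, ← hram a ha, hb]
      simp only [zero_mul, add_zero]
    rw [this, norm_neg, norm_one]; linarith
  exact klo_prime_weil hp a b ha hb

theorem klo_pp {p : ℕ} [Fact p.Prime] (k : ℕ) (hk : k ≠ 0) (N : ℕ) [NeZero N] (hN : N = p ^ k) (a b : ZMod N)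
    (hab : IsUnit a ∨ IsUnit b) :
    ‖kloK N a b‖ ≤ (k + 1) * Real.sqrt N := by
  have hpp : p.Prime := Fact.out
  have hp0 : (0 : ℝ) < p := by exact_mod_cast hpp.pos
  by_cases hk1 : k = 1
  · subst hk1
    rw [pow_one] at hN
    subst hN
    have := klo_pp_one a b hab
    norm_num
    linarith
  subst hN
  have hz : ∀ j, k ≤ j → (p : ZMod (p ^ k)) ^ j = 0 := by
    intro j hj
    have : ((p ^ j : ℕ) : ZMod (p ^ k)) = 0 := by
      rw [ZMod.natCast_eq_zero_iff]; exact pow_dvd_pow p hj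
    exact_mod_cast this
  rcases Nat.even_or_odd' k with ⟨m, hm | hm⟩
  · -- even
    have hm1 : 1 ≤ m := by omega
    have hsq : Real.sqrt ((p ^ k : ℕ) : ℝ) = (p : ℝ) ^ m := by
      rw [hm, mul_comm, pow_mul]; push_cast; rw [Real.sqrt_sq (by positivity)]
    rw [hsq]
    have h0 : (0 : ℝ) < (p : ℝ) ^ m := by positivity
    have hT := kloK_le_T (p ^ k) ((p ^ m : ℕ) : ZMod (p ^ k)) a b (by
      push_cast; rw [← pow_add]; exact hz _ (by omega))
    by_cases hp : p = 2
    · subst hp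
      by_cases hk2 : k = 2
      · have := kloK_trivial (2 ^ k) a b
        have hm' : m = 1 := by omega
        have htot : Nat.totient (2 ^ k) = 2 := by rw [hk2]; decide
        have hkk : (k : ℝ) = 2 := by rw [hk2]; norm_num
        rw [htot] at this
        rw [hm', hkk]
        clear hz hsq
        norm_num at this ⊢
        linarith
      · have h2 := klo_T_two (by omega : m < k) a b hab
        have h3 : ((kloT (2 ^ k) ((2 ^ m : ℕ) : ZMod (2 ^ k)) a b).card : ℝ) ≤ 4 * 2 ^ m := by exact_mod_cast h2
        have h4 : (3 : ℝ) ≤ k := by exact_mod_cast (by omega : 3 ≤ k)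
        have h5 := hT.trans h3
        push_cast at h0 ⊢
        nlinarith
    · have h2 := klo_T_odd hp (by omega : m < k) a b hab
      have h3 : ((kloT (p ^ k) ((p ^ m : ℕ) : ZMod (p ^ k)) a b).card : ℝ) ≤ 2 * p ^ m := by exact_mod_cast h2
      have h4 : (1 : ℝ) ≤ k := by exact_mod_cast (by omega : 1 ≤ k)
      have h5 := hT.trans h3
      nlinarith
  · have hm1 : 1 ≤ m := by omega
    have hsq : Real.sqrt ((p ^ k : ℕ) : ℝ) = (p : ℝ) ^ m * Real.sqrt p := by
      rw [hm, pow_succ, mul_comm 2 m, pow_mul]; push_cast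
      rw [Real.sqrt_mul (by positivity), Real.sqrt_sq (by positivity)]
    rw [hsq]
    have hs0 : 0 < Real.sqrt p := Real.sqrt_pos.2 hp0
    have hss : Real.sqrt p * Real.sqrt p = p := Real.mul_self_sqrt hp0.le
    have h0 : (0 : ℝ) < (p : ℝ) ^ m := by positivity
    by_cases hp : p = 2
    · subst hp
      by_cases hk2 : k = 3
      · have := kloK_trivial (2 ^ k) a b
        have hm' : m = 1 := by omega
        have htot : Nat.totient (2 ^ k) = 4 := by rw [hk2]; decide
        have hkk : (k : ℝ) = 3 := by rw [hk2]; norm_num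
        rw [htot] at this
        rw [hm', hkk]
        clear hz hsq
        have h9 : (1 : ℝ) ≤ Real.sqrt 2 := by rw [Real.one_le_sqrt]; norm_num
        norm_num at this ⊢
        linarith
      · have hT := kloK_le_T (2 ^ k) ((2 ^ (m + 1) : ℕ) : ZMod (2 ^ k)) a b (by
          push_cast; rw [← pow_add]; exact_mod_cast hz _ (by omega))
        have h2 := klo_T_two (by omega : m + 1 < k) a b hab
        have h3 : ((kloT (2 ^ k) ((2 ^ (m + 1) : ℕ) : ZMod (2 ^ k)) a b).card : ℝ) ≤ 4 * 2 ^ (m + 1) := by exact_mod_cast h2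
        have h4 : (5 : ℝ) ≤ k := by exact_mod_cast (by omega : 5 ≤ k)
        have h5 := hT.trans h3
        push_cast at h0 hs0 hss ⊢
        rw [pow_succ] at h5
        have h6 : (4 : ℝ) / 3 ≤ Real.sqrt 2 := by
          apply Real.le_sqrt_of_sq_le; norm_num
        have h7 : (8 : ℝ) ≤ (k + 1) * Real.sqrt 2 := by nlinarith
        nlinarith
    · have h2 := klo_T_odd hp (by omega : m + 1 < k) a b hab
      have h3 : ((kloT (p ^ k) ((p ^ (m + 1) : ℕ) : ZMod (p ^ k)) a b).card : ℝ) ≤ 2 * p ^ (m + 1) := by exact_mod_cast h2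
      have h4 : (1 : ℝ) ≤ k := by exact_mod_cast (by omega : 1 ≤ k)
      have hT : ‖kloK (p ^ k) a b‖ ≤ (kloT (p ^ k) ((p ^ (m + 1) : ℕ) : ZMod (p ^ k)) a b).card * (1 / Real.sqrt p) := by
        rcases Finset.eq_empty_or_nonempty (kloT (p ^ k) ((p ^ (m + 1) : ℕ) : ZMod (p ^ k)) a b) with h | ⟨x₀, hx₀⟩
        · have := kloK_le_T (p ^ k) ((p ^ (m + 1) : ℕ) : ZMod (p ^ k)) a b (by
            push_cast; rw [← pow_add]; exact_mod_cast hz _ (by omega))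
          rw [h] at this ⊢
          simpa using this
        obtain ⟨_, hb⟩ := klo_T_units (by omega) a b hab x₀ hx₀
        have hu2 : IsUnit (2 : ZMod (p ^ k)) := by
          have : IsUnit ((2 : ℕ) : ZMod (p ^ k)) := by
            rw [ZMod.isUnit_iff_coprime]
            exact ((Nat.coprime_primes Nat.prime_two Fact.out).2 (Ne.symm hp)).pow_right k
          exact_mod_cast this
        have hc : ((p ^ (m + 1) : ℕ) : ZMod (p ^ k)) = (p : ZMod (p ^ k)) ^ m * p := by push_cast; rw [pow_succ]
        rw [hc]
        refine kloK_le_T' (p ^ k) ((p : ZMod (p ^ k)) ^ m) p a b ?_ ?_ ?_ _ (by positivity) (p ^ (2 * m)) ?_ ?_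
        · rw [← pow_add, ← pow_succ]; exact hz _ (by omega)
        · rw [← pow_add, ← pow_add]; exact hz _ (by omega)
        · rw [← pow_succ, ← pow_add]; exact hz _ (by omega)
        · intro x
          classical
          refine le_trans (Finset.card_le_card ?_) (klo_tors (p ^ k) (p ^ (2 * m)) (pow_pos hpp.pos _))
          intro v hv
          simp only [Finset.mem_filter, Finset.mem_univ, true_and] at hv ⊢
          rw [← ((hu2.mul hb).mul x.isUnit).mul_right_eq_zero]
          rw [← hv]; push_cast; ring
        · rw [div_pow, one_pow, Real.sq_sqrt hp0.le, hm]
          push_cast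
          rw [pow_succ]
          field_simp
          exact le_rfl
      have h5 : ‖kloK (p ^ k) a b‖ ≤ 2 * p ^ (m + 1) * (1 / Real.sqrt p) :=
        hT.trans (mul_le_mul_of_nonneg_right h3 (by positivity))
      have h6 : 2 * (p : ℝ) ^ (m + 1) * (1 / Real.sqrt p) = 2 * (p ^ m * Real.sqrt p) := by
        rw [pow_succ]
        field_simp
        nlinarith
      rw [h6] at h5
      have : 0 < (p : ℝ) ^ m * Real.sqrt p := by positivity
      nlinarith


open Classical in
theorem klo_fibers {G H : Type*} [Group G] [Group H] [Fintype G] [Fintype H] (f : G →* H)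
    (hf : Function.Surjective f) (F : H → ℂ) (d : ℕ) (hd : Fintype.card G = d * Fintype.card H) :
    ∑ x : G, F (f x) = d * ∑ y : H, F y := by
  set c := (Finset.univ.filter (fun g => f g = 1)).card with hc
  have h0 : ∀ y, (Finset.univ.filter (fun g => f g = y)).card = c := by
    intro y
    exact MonoidHom.card_fiber_eq_of_mem_range f (hf y) (hf 1)
  have h1 : c * Fintype.card H = Fintype.card G := by
    have := Finset.card_eq_sum_card_fiberwise (s := (Finset.univ : Finset G)) (t := (Finset.univ : Finset H))
      (f := f) (fun _ _ => by simp)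
    rw [Finset.sum_congr rfl (fun y _ => h0 y), Finset.sum_const] at this
    simp only [Finset.card_univ, smul_eq_mul] at this
    rw [this, mul_comm]
  have h2 : c = d := by
    rw [hd] at h1
    exact Nat.eq_of_mul_eq_mul_right Fintype.card_pos h1
  rw [← Finset.sum_fiberwise_of_maps_to (s := Finset.univ) (t := Finset.univ) (g := f) (fun _ _ => Finset.mem_univ _),
    Finset.mul_sum]
  apply Finset.sum_congr rfl
  intro y _
  rw [← h2, ← h0 y, ← nsmul_eq_mul, ← Finset.sum_const]
  apply Finset.sum_congr rfl
  intro x hx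
  simp only [Finset.mem_filter, Finset.mem_univ, true_and] at hx
  rw [hx]

theorem klo_descend (N d M : ℕ) [NeZero N] [NeZero M] (hN : N = d * M) (hφ : N.totient = d * M.totient) (a b : ℤ) :
    kloK N ((d * a : ℤ) : ZMod N) ((d * b : ℤ) : ZMod N) = d * kloK M (a : ZMod M) (b : ZMod M) := by
  have hdvd : M ∣ N := ⟨d, by rw [hN, mul_comm]⟩
  rw [kloK, kloK, ← klo_fibers (ZMod.unitsMap hdvd) (ZMod.unitsMap_surjective hdvd) _ d
    (by rw [ZMod.card_units_eq_totient, ZMod.card_units_eq_totient, hφ])]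
  apply Finset.sum_congr rfl
  intro x _
  obtain ⟨X, hX⟩ := ZMod.intCast_surjective (x : ZMod N)
  obtain ⟨Y, hY⟩ := ZMod.intCast_surjective ((x⁻¹ : (ZMod N)ˣ) : ZMod N)
  have h1 : ((ZMod.unitsMap hdvd x : (ZMod M)ˣ) : ZMod M) = X := by
    rw [ZMod.unitsMap_def, Units.coe_map, ← hX]
    simp
  have h2 : (((ZMod.unitsMap hdvd x)⁻¹ : (ZMod M)ˣ) : ZMod M) = Y := by
    rw [← map_inv, ZMod.unitsMap_def, Units.coe_map, ← hY]
    simp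
  rw [h1, h2, ← hX, ← hY]
  have h3 : (((d * a : ℤ) : ZMod N) * (X : ZMod N) + ((d * b : ℤ) : ZMod N) * (Y : ZMod N)) =
      ((d * (a * X + b * Y) : ℤ) : ZMod N) := by push_cast; ring
  have h4 : ((a : ZMod M) * (X : ZMod M) + (b : ZMod M) * (Y : ZMod M)) = ((a * X + b * Y : ℤ) : ZMod M) := by
    push_cast; ring
  rw [h3, h4, ZMod.stdAddChar_coe, ZMod.stdAddChar_coe]
  congr 1
  have hM : (M : ℂ) ≠ 0 := by exact_mod_cast NeZero.ne M
  have hd : (d : ℂ) ≠ 0 := by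
    have : N ≠ 0 := NeZero.ne N
    rw [hN] at this
    exact_mod_cast left_ne_zero_of_mul this
  rw [hN]
  push_cast
  field_simp

theorem klo_crt (m n : ℕ) [NeZero m] [NeZero n] [NeZero (m * n)] (h : m.Coprime n) (u v : ℤ) (huv : u * n + v * m = 1)
    (a b : ℤ) : kloK (m * n) (a : ZMod (m * n)) (b : ZMod (m * n)) =
      kloK m ((u * a : ℤ) : ZMod m) ((u * b : ℤ) : ZMod m) * kloK n ((v * a : ℤ) : ZMod n) ((v * b : ℤ) : ZMod n) := by
  have hm : (m : ℂ) ≠ 0 := by exact_mod_cast NeZero.ne m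
  have hn : (n : ℂ) ≠ 0 := by exact_mod_cast NeZero.ne n
  have huv' : (u : ℂ) * n + v * m = 1 := by exact_mod_cast huv
  rw [kloK, kloK, kloK, Finset.sum_mul_sum, ← Finset.sum_product', Finset.univ_product_univ]
  let e : (ZMod (m * n))ˣ ≃* (ZMod m)ˣ × (ZMod n)ˣ :=
    (Units.mapEquiv (ZMod.chineseRemainder h).toMulEquiv).trans MulEquiv.prodUnits
  have he1 : ∀ x, (((e x).1 : (ZMod m)ˣ) : ZMod m) = (ZMod.chineseRemainder h (x : ZMod (m * n))).1 := fun x => rfl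
  have he2 : ∀ x, (((e x).2 : (ZMod n)ˣ) : ZMod n) = (ZMod.chineseRemainder h (x : ZMod (m * n))).2 := fun x => rfl
  refine Fintype.sum_equiv e.toEquiv _ _ ?_
  intro x
  obtain ⟨X, hX⟩ := ZMod.intCast_surjective (x : ZMod (m * n))
  obtain ⟨Y, hY⟩ := ZMod.intCast_surjective ((x⁻¹ : (ZMod (m * n))ˣ) : ZMod (m * n))
  have h1 : (((e x).1 : (ZMod m)ˣ) : ZMod m) = X := by rw [he1, ← hX, map_intCast]; rfl
  have h2 : (((e x).2 : (ZMod n)ˣ) : ZMod n) = X := by rw [he2, ← hX, map_intCast]; rfl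
  have h3 : ((((e x).1)⁻¹ : (ZMod m)ˣ) : ZMod m) = Y := by
    rw [← Prod.fst_inv, ← map_inv, he1, ← hY, map_intCast]; rfl
  have h4 : ((((e x).2)⁻¹ : (ZMod n)ˣ) : ZMod n) = Y := by
    rw [← Prod.snd_inv, ← map_inv, he2, ← hY, map_intCast]; rfl
  change _ = ZMod.stdAddChar (((u * a : ℤ) : ZMod m) * (((e x).1 : (ZMod m)ˣ) : ZMod m) +
      ((u * b : ℤ) : ZMod m) * ((((e x).1)⁻¹ : (ZMod m)ˣ) : ZMod m)) *
    ZMod.stdAddChar (((v * a : ℤ) : ZMod n) * (((e x).2 : (ZMod n)ˣ) : ZMod n) +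
      ((v * b : ℤ) : ZMod n) * ((((e x).2)⁻¹ : (ZMod n)ˣ) : ZMod n))
  rw [h1, h2, h3, h4, ← hX, ← hY]
  have h5 : ((a : ZMod (m * n)) * (X : ZMod (m * n)) + (b : ZMod (m * n)) * (Y : ZMod (m * n))) =
      ((a * X + b * Y : ℤ) : ZMod (m * n)) := by push_cast; ring
  have h6 : (((u * a : ℤ) : ZMod m) * (X : ZMod m) + ((u * b : ℤ) : ZMod m) * (Y : ZMod m)) =
      ((u * (a * X + b * Y) : ℤ) : ZMod m) := by push_cast; ring
  have h7 : (((v * a : ℤ) : ZMod n) * (X : ZMod n) + ((v * b : ℤ) : ZMod n) * (Y : ZMod n)) =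
      ((v * (a * X + b * Y) : ℤ) : ZMod n) := by push_cast; ring
  rw [h5, h6, h7, ZMod.stdAddChar_coe, ZMod.stdAddChar_coe, ZMod.stdAddChar_coe, ← Complex.exp_add]
  congr 1
  generalize a * X + b * Y = z
  push_cast
  field_simp
  linear_combination (-(z : ℂ)) * huv'

theorem klo_pp_gen {p : ℕ} [Fact p.Prime] (k : ℕ) (N : ℕ) [NeZero N] (hN : N = p ^ k) (a b : ℤ) :
    ‖kloK N (a : ZMod N) (b : ZMod N)‖ ≤
      (N.divisors.card : ℝ) * Real.sqrt (Nat.gcd (Int.gcd a b) N) * Real.sqrt N := by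
  have hpp : p.Prime := Fact.out
  have hp0 : (0 : ℝ) < p := by exact_mod_cast hpp.pos
  have hdc : N.divisors.card = k + 1 := by
    rw [hN, Nat.divisors_prime_pow hpp]; simp
  have hN0 : (0 : ℝ) < N := by exact_mod_cast NeZero.pos N
  rw [hdc]
  have hg : Nat.gcd (Int.gcd a b) N ∣ p ^ k := by rw [← hN]; exact Nat.gcd_dvd_right _ _
  obtain ⟨j, hj, hgj⟩ := (Nat.dvd_prime_pow hpp).1 hg
  have htriv : ‖kloK N (a : ZMod N) (b : ZMod N)‖ ≤ N :=
    (kloK_trivial N _ _).trans (by exact_mod_cast Nat.totient_le N)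
  rw [hgj]
  rcases eq_or_lt_of_le hj with rfl | hjk
  · rw [← hN, mul_assoc, Real.mul_self_sqrt hN0.le]
    refine htriv.trans ?_
    push_cast
    have : (0 : ℝ) ≤ j := Nat.cast_nonneg j
    nlinarith
  have hga : (p ^ j : ℕ) ∣ Int.gcd a b := by rw [← hgj]; exact Nat.gcd_dvd_left _ _
  obtain ⟨a', ha'⟩ : ((p ^ j : ℕ) : ℤ) ∣ a := (Int.natCast_dvd_natCast.2 hga).trans (Int.gcd_dvd_left ..)
  obtain ⟨b', hb'⟩ : ((p ^ j : ℕ) : ℤ) ∣ b := (Int.natCast_dvd_natCast.2 hga).trans (Int.gcd_dvd_right ..)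
  have hnd : ¬ ((p : ℤ) ∣ a' ∧ (p : ℤ) ∣ b') := by
    rintro ⟨h1, h2⟩
    have h3 : (p ^ (j + 1) : ℕ) ∣ Nat.gcd (Int.gcd a b) N := by
      apply Nat.dvd_gcd
      · apply Int.natCast_dvd_natCast.1
        apply Int.dvd_coe_gcd
        · rw [ha', pow_succ]; push_cast; exact mul_dvd_mul_left _ h1
        · rw [hb', pow_succ]; push_cast; exact mul_dvd_mul_left _ h2
      · rw [hN]; exact pow_dvd_pow p hjk
    rw [hgj, Nat.pow_dvd_pow_iff_le_right hpp.one_lt] at h3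
    omega
  have hNM : N = p ^ j * p ^ (k - j) := by rw [hN, ← pow_add]; congr 1; omega
  have : NeZero (p ^ (k - j)) := ⟨(pow_pos hpp.pos _).ne'⟩
  have hφ : N.totient = p ^ j * (p ^ (k - j)).totient := by
    rw [hN, Nat.totient_prime_pow hpp (by omega), Nat.totient_prime_pow hpp (by omega), ← mul_assoc, ← pow_add]
    congr 2; omega
  have hD := klo_descend N (p ^ j) (p ^ (k - j)) hNM hφ a' b'
  rw [← ha', ← hb'] at hD
  have hunit : ∀ z : ℤ, ¬ (p : ℤ) ∣ z → IsUnit ((z : ℤ) : ZMod (p ^ (k - j))) := by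
    intro z hz
    rcases klo_unit_or ((z : ℤ) : ZMod (p ^ (k - j))) with h | ⟨w, hw⟩
    · exact h
    exfalso
    apply hz
    obtain ⟨W, hW⟩ := ZMod.intCast_surjective w
    rw [← hW] at hw
    have h1 : ((z - p * W : ℤ) : ZMod (p ^ (k - j))) = 0 := by push_cast; rw [hw]; ring
    rw [ZMod.intCast_zmod_eq_zero_iff_dvd] at h1
    have h2 : (p : ℤ) ∣ z - p * W := by
      refine dvd_trans ?_ h1
      push_cast
      exact dvd_pow_self _ (by omega)
    have := dvd_add h2 (dvd_mul_right (p : ℤ) W)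
    simpa using this
  have hP := klo_pp (k - j) (by omega) (p ^ (k - j)) rfl (a' : ZMod (p ^ (k - j))) (b' : ZMod (p ^ (k - j))) (by
    by_cases h : (p : ℤ) ∣ a'
    · right; exact hunit _ (fun h' => hnd ⟨h, h'⟩)
    · left; exact hunit _ h)
  rw [hD, norm_mul, Complex.norm_natCast, hNM]
  have hs : Real.sqrt ((p ^ j * p ^ (k - j) : ℕ) : ℝ) = Real.sqrt ((p ^ j : ℕ) : ℝ) * Real.sqrt ((p ^ (k - j) : ℕ) : ℝ) := by
    rw [Nat.cast_mul, Real.sqrt_mul (by positivity)]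
  rw [hs]
  have h8 : Real.sqrt ((p ^ j : ℕ) : ℝ) * Real.sqrt ((p ^ j : ℕ) : ℝ) = ((p ^ j : ℕ) : ℝ) := Real.mul_self_sqrt (by positivity)
  have h9 : ((k - j : ℕ) : ℝ) ≤ k := by exact_mod_cast Nat.sub_le k j
  calc ((p ^ j : ℕ) : ℝ) * ‖kloK (p ^ (k - j)) (a' : ZMod (p ^ (k - j))) (b' : ZMod (p ^ (k - j)))‖
      ≤ ((p ^ j : ℕ) : ℝ) * ((k + 1) * Real.sqrt ((p ^ (k - j) : ℕ) : ℝ)) := by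
        refine mul_le_mul_of_nonneg_left (hP.trans ?_) (by positivity)
        refine mul_le_mul_of_nonneg_right (by linarith) (Real.sqrt_nonneg _)
    _ = _ := by
        rw [Nat.cast_add, Nat.cast_one]
        linear_combination (-((k : ℝ) + 1) * Real.sqrt ((p ^ (k - j) : ℕ) : ℝ)) * h8

theorem klo_main (N : ℕ) : ∀ [NeZero N] (a b : ℤ), ‖kloK N (a : ZMod N) (b : ZMod N)‖ ≤
      (N.divisors.card : ℝ) * Real.sqrt (Nat.gcd (Int.gcd a b) N) * Real.sqrt N := by
  induction N using Nat.recOnPosPrimePosCoprime with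
  | prime_pow p n hp hn =>
    intro _ a b
    have : Fact p.Prime := ⟨hp⟩
    exact klo_pp_gen n (p ^ n) rfl a b
  | zero => intro h; exact absurd rfl h.out
  | one =>
    intro _ a b
    have := kloK_trivial 1 (a : ZMod 1) (b : ZMod 1)
    simpa using this
  | coprime m n hm hn h ihm ihn =>
    intro _ a b
    have : NeZero m := ⟨by omega⟩
    have : NeZero n := ⟨by omega⟩
    have hbez := Nat.gcd_eq_gcd_ab m n
    rw [h] at hbez
    set v := Nat.gcdA m n
    set u := Nat.gcdB m n
    have huv : u * n + v * m = 1 := by push_cast at hbez; linarith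
    have hum : Nat.Coprime u.natAbs m := by
      have : IsCoprime u (m : ℤ) := ⟨n, v, by linarith⟩
      simpa [Int.isCoprime_iff_gcd_eq_one, Int.gcd, Nat.Coprime] using this
    have hvn : Nat.Coprime v.natAbs n := by
      have : IsCoprime v (n : ℤ) := ⟨m, u, by linarith⟩
      simpa [Int.isCoprime_iff_gcd_eq_one, Int.gcd, Nat.Coprime] using this
    have h1 := ihm (u * a) (u * b)
    have h2 := ihn (v * a) (v * b)
    rw [Int.gcd_mul_left, Nat.Coprime.gcd_mul_left_cancel _ hum] at h1
    rw [Int.gcd_mul_left, Nat.Coprime.gcd_mul_left_cancel _ hvn] at h2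
    rw [klo_crt m n h u v huv, norm_mul, h.card_divisors_mul, Nat.Coprime.gcd_mul _ h]
    rw [Nat.cast_mul, Nat.cast_mul, Nat.cast_mul, Real.sqrt_mul (by positivity), Real.sqrt_mul (by positivity)]
    refine (mul_le_mul h1 h2 (norm_nonneg _) (by positivity)).trans (le_of_eq ?_)
    ring

theorem stmt_17 (c : ℕ) [NeZero c] (a₁ a₂ : ℤ) :
    ‖∑ x : (ZMod c)ˣ, Complex.exp (2 * (Real.pi : ℂ) * Complex.I *
        (((a₁ * ((x : ZMod c).val : ℤ)
          + a₂ * (((x⁻¹ : (ZMod c)ˣ) : ZMod c).val : ℤ) : ℤ)) : ℂ) / c)‖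
      ≤ (c.divisors.card : ℝ) * Real.sqrt (Int.gcd (Int.gcd a₁ a₂) c) * Real.sqrt c := by
  have h := klo_main c a₁ a₂
  rw [Int.gcd_natCast_natCast]
  convert h using 2
  rw [kloK]
  apply Finset.sum_congr rfl
  intro x _
  rw [← ZMod.stdAddChar_coe]
  congr 1
  push_cast
  rw [ZMod.natCast_zmod_val, ZMod.natCast_zmod_val]
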